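/- arXiv:1410.8838 — 8 statements merged into one kernel-verified Lean document; each statement's English description precedes it below -/
import Mathlib

section
/- The monoid 𝓕 presented by two generators x, x⋆ subject to the relations x·x⋆·x = x, x⋆·x·x⋆ = x⋆, and p·q = q·p for all p, q in the set {x^i(x⋆)^i, (x⋆)^j x^j : i, j ≥ 0} is an inverse monoid: for every element a of 𝓕 there exists a unique element b of 𝓕 with a·b·a = a and b·a·b = b. -/
/- The monogenic free inverse monoid 𝓕, presented by generators `x, x⋆` with relations
`x·x⋆·x = x`, `x⋆·x·x⋆ = x⋆`, and `p·q = q·p` for `p, q ∈ {x^i(x⋆)^i, (x⋆)^j x^j}`. -/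

namespace MonogenicFreeInverse

/-- the generator `x` (as a word in the free monoid on two letters) -/
def xg : FreeMonoid Bool := FreeMonoid.of true

/-- the generator `x⋆` (as a word in the free monoid on two letters) -/
def xs : FreeMonoid Bool := FreeMonoid.of false

/-- the set of words `x^i (x⋆)^i` and `(x⋆)^j x^j`, `i, j ≥ 0` -/
def idemWords : Set (FreeMonoid Bool) :=
  {w | (∃ i : ℕ, w = xg ^ i * xs ^ i) ∨ (∃ j : ℕ, w = xs ^ j * xg ^ j)}

/-- the defining relations of `𝓕` -/
inductive Rel : FreeMonoid Bool → FreeMonoid Bool → Prop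
  | reg1 : Rel (xg * xs * xg) xg
  | reg2 : Rel (xs * xg * xs) xs
  | comm (p q : FreeMonoid Bool) (hp : p ∈ idemWords) (hq : q ∈ idemWords) :
      Rel (p * q) (q * p)

/-- the monogenic free inverse monoid: the quotient of the free monoid on `{x, x⋆}` by the
congruence generated by the relations `Rel` -/
abbrev F : Type := (conGen Rel).Quotient

section Abstract

variable {M : Type*} [Monoid M]

/-- the elements `x ^ i * s ^ i` and `s ^ i * x ^ i` of a monoid -/
def basicIdem (x s : M) : Set M := {p | ∃ i : ℕ, p = x ^ i * s ^ i ∨ p = s ^ i * x ^ i}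

/-- the hypotheses on a pair of elements expressed by the defining relations of `F` -/
structure IsInversePair (x s : M) : Prop where
  left : x * s * x = x
  right : s * x * s = s
  comm : ∀ p ∈ basicIdem x s, ∀ q ∈ basicIdem x s, p * q = q * p

lemma basicIdem_swap (x s : M) : basicIdem s x = basicIdem x s := by
  ext p
  simp only [basicIdem, Set.mem_ofPred_eq, or_comm]

lemma pow_mul_pow_mem_basicIdem (x s : M) (n : ℕ) : x ^ n * s ^ n ∈ basicIdem x s :=
  ⟨n, Or.inl rfl⟩

lemma pow_mul_pow_mem_basicIdem' (x s : M) (n : ℕ) : s ^ n * x ^ n ∈ basicIdem x s :=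
  ⟨n, Or.inr rfl⟩

namespace IsInversePair

variable {x s : M}

lemma swap (h : IsInversePair x s) : IsInversePair s x :=
  ⟨h.right, h.left, by rw [basicIdem_swap]; exact h.comm⟩

lemma comm_pow_one (h : IsInversePair x s) (n : ℕ) :
    x ^ n * s ^ n * (s * x) = s * x * (x ^ n * s ^ n) := by
  simpa using h.comm _ (pow_mul_pow_mem_basicIdem x s n) _ (pow_mul_pow_mem_basicIdem' x s 1)

lemma pow_mul_pow_mul_pow (h : IsInversePair x s) (n : ℕ) : x ^ n * s ^ n * x ^ n = x ^ n := by
  induction n with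
  | zero => simp
  | succ n ih =>
    calc x ^ (n + 1) * s ^ (n + 1) * x ^ (n + 1)
        = x * (x ^ n * s ^ n * (s * x)) * x ^ n := by
          rw [pow_succ' x n, pow_succ s n]; simp only [mul_assoc]
      _ = x * s * x * (x ^ n * s ^ n * x ^ n) := by
          rw [h.comm_pow_one]; simp only [mul_assoc]
      _ = x ^ (n + 1) := by rw [h.left, ih, pow_succ']

lemma pow_succ_mul (h : IsInversePair x s) (n : ℕ) :
    s ^ (n + 1) * x = s ^ (n + 1) * x ^ (n + 1) * s ^ n := by
  calc s ^ (n + 1) * x = s ^ n * x ^ n * s ^ n * (s * x) := by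
        rw [h.swap.pow_mul_pow_mul_pow, pow_succ, mul_assoc]
    _ = s ^ n * (x ^ n * s ^ n * (s * x)) := by simp only [mul_assoc]
    _ = s ^ (n + 1) * x ^ (n + 1) * s ^ n := by
        rw [h.comm_pow_one, pow_succ s n, pow_succ' x n]; simp only [mul_assoc]

lemma isIdempotentElem_of_mem_basicIdem (h : IsInversePair x s) {p : M}
    (hp : p ∈ basicIdem x s) : p * p = p := by
  obtain ⟨i, rfl | rfl⟩ := hp
  · rw [← mul_assoc, h.pow_mul_pow_mul_pow]
  · rw [← mul_assoc, h.swap.pow_mul_pow_mul_pow]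

lemma comm_of_mem_closure (h : IsInversePair x s) {u v : M}
    (hu : u ∈ Submonoid.closure (basicIdem x s)) (hv : v ∈ Submonoid.closure (basicIdem x s)) :
    u * v = v * u := by
  induction hu, hv using Submonoid.closure_induction₂ with
  | mem p q hp hq => exact h.comm p hp q hq
  | one_left => simp
  | one_right => simp
  | mul_left a b c _ _ _ h₁ h₂ => exact Commute.mul_left h₁ h₂
  | mul_right a b c _ _ _ h₁ h₂ => exact Commute.mul_right h₁ h₂

lemma isIdempotentElem_of_mem_closure (h : IsInversePair x s) {u : M}
    (hu : u ∈ Submonoid.closure (basicIdem x s)) : u * u = u := by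
  induction hu using Submonoid.closure_induction with
  | mem p hp => exact h.isIdempotentElem_of_mem_basicIdem hp
  | one => simp
  | mul a b ha hb iha ihb =>
    rw [mul_assoc, ← mul_assoc b, h.comm_of_mem_closure hb ha, mul_assoc, ihb, ← mul_assoc, iha]

lemma exists_normal_form_mul (h : IsInversePair x s) {a : M}
    (ha : ∃ u ∈ Submonoid.closure (basicIdem x s), ∃ n : ℕ, a = u * x ^ n ∨ a = u * s ^ n) :
    ∃ u ∈ Submonoid.closure (basicIdem x s), ∃ n : ℕ, a * x = u * x ^ n ∨ a * x = u * s ^ n := by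
  obtain ⟨u, hu, n, rfl | rfl⟩ := ha
  · exact ⟨u, hu, n + 1, Or.inl (by rw [pow_succ, mul_assoc])⟩
  · cases n with
    | zero => exact ⟨u, hu, 1, Or.inl (by simp)⟩
    | succ n =>
      refine ⟨u * (s ^ (n + 1) * x ^ (n + 1)), mul_mem hu
        (Submonoid.subset_closure (pow_mul_pow_mem_basicIdem' x s _)), n, Or.inr ?_⟩
      rw [mul_assoc, h.pow_succ_mul, mul_assoc, mul_assoc, mul_assoc]

lemma exists_normal_form (h : IsInversePair x s) (hgen : Submonoid.closure {x, s} = ⊤) (a : M) :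
    ∃ u ∈ Submonoid.closure (basicIdem x s), ∃ n : ℕ, a = u * x ^ n ∨ a = u * s ^ n := by
  have ha : a ∈ Submonoid.closure {x, s} := hgen ▸ Submonoid.mem_top a
  induction ha using Submonoid.closure_induction_right with
  | one => exact ⟨1, one_mem _, 0, by simp⟩
  | mul_right a _ y hy ih =>
    obtain rfl | rfl := hy
    · exact h.exists_normal_form_mul ih
    · have := h.swap.exists_normal_form_mul (a := a)
      simp only [basicIdem_swap, or_comm] at this ih ⊢
      simpa only [or_comm] using this (by simpa only [or_comm] using ih)

lemma exists_inverse_of_mul_pow (h : IsInversePair x s) {u : M}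
    (hu : u ∈ Submonoid.closure (basicIdem x s)) (n : ℕ) :
    ∃ b, u * x ^ n * b * (u * x ^ n) = u * x ^ n ∧ b * (u * x ^ n) * b = b := by
  have huu := h.isIdempotentElem_of_mem_closure hu
  have hc := h.comm_of_mem_closure hu
    (Submonoid.subset_closure (pow_mul_pow_mem_basicIdem x s n))
  refine ⟨s ^ n * u, ?_, ?_⟩
  · calc u * x ^ n * (s ^ n * u) * (u * x ^ n)
        = u * (x ^ n * s ^ n) * (u * u) * x ^ n := by simp only [mul_assoc]
      _ = u * u * (x ^ n * s ^ n * x ^ n) := by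
        rw [huu, mul_assoc u, ← hc, ← mul_assoc u, huu]; simp only [mul_assoc]
      _ = u * x ^ n := by rw [huu, h.pow_mul_pow_mul_pow]
  · calc s ^ n * u * (u * x ^ n) * (s ^ n * u)
        = s ^ n * (u * u * (x ^ n * s ^ n)) * u := by simp only [mul_assoc]
      _ = s ^ n * x ^ n * s ^ n * (u * u) := by rw [huu, hc]; simp only [mul_assoc, huu]
      _ = s ^ n * u := by rw [huu, h.swap.pow_mul_pow_mul_pow]

lemma exists_inverse (h : IsInversePair x s) (hgen : Submonoid.closure {x, s} = ⊤) (a : M) :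
    ∃ b, a * b * a = a ∧ b * a * b = b := by
  obtain ⟨u, hu, n, rfl | rfl⟩ := h.exists_normal_form hgen a
  · exact h.exists_inverse_of_mul_pow hu n
  · exact h.swap.exists_inverse_of_mul_pow (basicIdem_swap x s ▸ hu) n

lemma mem_closure_of_isIdempotentElem (h : IsInversePair x s)
    (hgen : Submonoid.closure {x, s} = ⊤) (deg : M →* Multiplicative ℤ)
    (hx : deg x = .ofAdd 1) (hs : deg s = .ofAdd (-1)) {a : M} (ha : a * a = a) :
    a ∈ Submonoid.closure (basicIdem x s) := by
  have hdeg : deg a = 1 := by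
    have := congrArg deg ha
    rwa [map_mul, mul_eq_left] at this
  obtain ⟨u, hu, n, hn⟩ := h.exists_normal_form hgen a
  have hu1 : deg u = 1 := by
    have := congrArg deg (h.isIdempotentElem_of_mem_closure hu)
    rwa [map_mul, mul_eq_left] at this
  have hn0 : n = 0 := by
    obtain rfl | rfl := hn
    · rw [map_mul, map_pow, hu1, hx, one_mul, ← ofAdd_nsmul, ofAdd_eq_one] at hdeg
      simpa using hdeg
    · rw [map_mul, map_pow, hu1, hs, one_mul, ← ofAdd_nsmul, ofAdd_eq_one] at hdeg
      simpa using hdeg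
  subst hn0
  simp only [pow_zero, mul_one, or_self] at hn
  exact hn ▸ hu

end IsInversePair

lemma inverse_unique_of_idempotents_commute
    (hcomm : ∀ e f : M, e * e = e → f * f = f → e * f = f * e) {a b c : M}
    (hab : a * b * a = a) (hba : b * a * b = b) (hac : a * c * a = a) (hca : c * a * c = c) :
    b = c := by
  have hr := hcomm (a * b) (a * c) (by rw [← mul_assoc, hab]) (by rw [← mul_assoc, hac])
  have hl := hcomm (b * a) (c * a) (by rw [← mul_assoc, hba]) (by rw [← mul_assoc, hca])
  calc b = b * (a * c * a) * b := by rw [hac, hba]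
    _ = b * (a * c * (a * b)) := by simp only [mul_assoc]
    _ = b * a * b * a * c := by rw [← hr]; simp only [mul_assoc]
    _ = b * a * c := by rw [hba]
    _ = b * a * (c * a * c) := by rw [hca]
    _ = b * a * (c * a) * c := by simp only [mul_assoc]
    _ = c * (a * b * a) * c := by rw [hl]; simp only [mul_assoc]
    _ = c := by rw [hab, hca]

end Abstract

/-- the class of a word in `F` -/
def toF : FreeMonoid Bool →* F := (conGen Rel).mk'

lemma toF_eq {v w : FreeMonoid Bool} (h : Rel v w) : toF v = toF w :=
  (Con.eq _).2 (ConGen.Rel.of _ _ h)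

lemma toF_surjective : Function.Surjective toF := Con.mk'_surjective

lemma basicIdem_toF {p : F} (hp : p ∈ basicIdem (toF xg) (toF xs)) :
    ∃ w ∈ idemWords, toF w = p := by
  obtain ⟨i, rfl | rfl⟩ := hp
  · exact ⟨_, Or.inl ⟨i, rfl⟩, by simp⟩
  · exact ⟨_, Or.inr ⟨i, rfl⟩, by simp⟩

lemma isInversePair_toF : IsInversePair (toF xg) (toF xs) where
  left := by simpa only [map_mul] using toF_eq Rel.reg1
  right := by simpa only [map_mul] using toF_eq Rel.reg2
  comm p hp q hq := by
    obtain ⟨v, hv, rfl⟩ := basicIdem_toF hp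
    obtain ⟨w, hw, rfl⟩ := basicIdem_toF hq
    simpa only [map_mul] using toF_eq (Rel.comm v w hv hw)

lemma closure_toF : Submonoid.closure {toF xg, toF xs} = ⊤ := by
  rw [eq_top_iff]
  rintro a -
  obtain ⟨w, rfl⟩ := toF_surjective a
  induction w using FreeMonoid.inductionOn' with
  | one => simp
  | of_mul y w ih =>
    rw [map_mul]
    refine mul_mem (Submonoid.subset_closure ?_) ih
    cases y
    · exact Or.inr rfl
    · exact Or.inl rfl

/-- the exponent sum of a word, with `x` counted positively and `x⋆` negatively -/
def wordDegree : FreeMonoid Bool →* Multiplicative ℤ :=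
  FreeMonoid.lift fun y => .ofAdd (if y then 1 else -1)

lemma wordDegree_xg : wordDegree xg = .ofAdd 1 := by simp [wordDegree, xg]

lemma wordDegree_xs : wordDegree xs = .ofAdd (-1) := by simp [wordDegree, xs]

lemma conGen_le_ker_wordDegree : conGen Rel ≤ Con.ker wordDegree := by
  refine Con.conGen_le.2 fun v w h => ?_
  rw [Con.ker_rel]
  cases h with
  | reg1 => simp [wordDegree_xg, wordDegree_xs]
  | reg2 => simp [wordDegree_xg, wordDegree_xs]
  | comm p q _ _ => rw [map_mul, map_mul, mul_comm]

/-- the exponent sum of an element of `F` -/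
def degree : F →* Multiplicative ℤ := (conGen Rel).lift wordDegree conGen_le_ker_wordDegree

end MonogenicFreeInverse

open MonogenicFreeInverse in
/-- `𝓕` is an inverse monoid: every element has a unique generalized inverse. -/
theorem stmt0 :
    ∀ a : F, ∃! b : F, a * b * a = a ∧ b * a * b = b := by
  intro a
  have hmem {e : F} (he : e * e = e) :=
    isInversePair_toF.mem_closure_of_isIdempotentElem closure_toF degree
      wordDegree_xg wordDegree_xs he
  obtain ⟨b, hab, hba⟩ := isInversePair_toF.exists_inverse closure_toF a
  exact ⟨b, ⟨hab, hba⟩, fun c ⟨hac, hca⟩ => inverse_unique_of_idempotents_commute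
    (fun e f he hf => isInversePair_toF.comm_of_mem_closure (hmem he) (hmem hf)) hac hca hab hba⟩
end

section
/- In the monoid 𝓕, every element can be written in the form x^i (x⋆)^j x^k (image of the corresponding word) for some integers i, j, k with j ≥ i ≥ 0 and j ≥ k ≥ 0. -/
namespace MonogenicFreeInverse

section Monoid

variable {M : Type*} [Monoid M] {x s : M}

/-- Left multiplication by `x` at `i = j` raises all three exponents by one. -/
theorem pow_succ_mul_pow_succ_mul_pow_succ (hx : x * s * x = x)
    (hc : ∀ n : ℕ, Commute (s * x) (x ^ n * s ^ n)) (j k : ℕ) :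
    x ^ (j + 1) * s ^ (j + 1) * x ^ (k + 1) = x * (x ^ j * s ^ j * x ^ k) := by
  calc x ^ (j + 1) * s ^ (j + 1) * x ^ (k + 1)
      = x * ((x ^ j * s ^ j) * (s * x)) * x ^ k := by
        rw [pow_succ' x j, pow_succ s j, pow_succ' x k]
        simp only [mul_assoc]
    _ = x * s * x * (x ^ j * s ^ j * x ^ k) := by
        rw [← (hc j).eq]
        simp only [mul_assoc]
    _ = x * (x ^ j * s ^ j * x ^ k) := by rw [hx]

/-- Left multiplication by `s` cancels a leading `x` when `i < j`. -/
theorem mul_pow_succ_mul_pow_of_lt (hs : s * x * s = s)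
    (hc : ∀ n : ℕ, Commute (s * x) (x ^ n * s ^ n)) {i j : ℕ} (hij : i < j) :
    s * (x ^ (i + 1) * s ^ j) = x ^ i * s ^ j := by
  obtain ⟨d, rfl⟩ := Nat.exists_eq_add_of_lt hij
  calc s * (x ^ (i + 1) * s ^ (i + d + 1))
      = (s * x) * (x ^ i * s ^ i) * (s * s ^ d) := by
        rw [pow_succ' x i, add_assoc, pow_add s i, pow_succ' s d]
        simp only [mul_assoc]
    _ = x ^ i * s ^ i * (s * x * s * s ^ d) := by
        rw [(hc i).eq]
        simp only [mul_assoc]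
    _ = x ^ i * s ^ (i + d + 1) := by
        rw [hs, add_assoc, pow_add s i, pow_succ' s d]
        simp only [mul_assoc]

end Monoid

theorem mk'_eq_of_rel {v w : FreeMonoid Bool} (h : Rel v w) :
    (conGen Rel).mk' v = (conGen Rel).mk' w :=
  (Con.eq _).2 (ConGen.Rel.of _ _ h)

theorem commute_mk'_xs_mul_xg (n : ℕ) :
    Commute ((conGen Rel).mk' xs * (conGen Rel).mk' xg)
      ((conGen Rel).mk' xg ^ n * (conGen Rel).mk' xs ^ n) := by
  have h := mk'_eq_of_rel (Rel.comm (xs ^ 1 * xg ^ 1) (xg ^ n * xs ^ n)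
    (Or.inr ⟨1, rfl⟩) (Or.inl ⟨n, rfl⟩))
  simpa only [map_mul, map_pow, pow_one, Commute, SemiconjBy] using h

end MonogenicFreeInverse

open MonogenicFreeInverse in
/-- Every element of `𝓕` can be written in the form `x^i (x⋆)^j x^k` with
`j ≥ i ≥ 0` and `j ≥ k ≥ 0`. -/
theorem stmt1 :
    ∀ a : F, ∃ i j k : ℕ, i ≤ j ∧ k ≤ j ∧
      a = (conGen Rel).mk' (xg ^ i * xs ^ j * xg ^ k) := by
  have hx : (conGen Rel).mk' xg * (conGen Rel).mk' xs * (conGen Rel).mk' xg =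
      (conGen Rel).mk' xg := by
    simpa only [map_mul] using mk'_eq_of_rel Rel.reg1
  have hs : (conGen Rel).mk' xs * (conGen Rel).mk' xg * (conGen Rel).mk' xs =
      (conGen Rel).mk' xs := by
    simpa only [map_mul] using mk'_eq_of_rel Rel.reg2
  intro a
  obtain ⟨w, rfl⟩ := Con.mk'_surjective a
  simp only [map_mul, map_pow]
  induction w using FreeMonoid.inductionOn' with
  | one => exact ⟨0, 0, 0, le_rfl, le_rfl, by simp⟩
  | of_mul b w ih =>
    obtain ⟨i, j, k, hij, hkj, hw⟩ := ih
    rw [map_mul, hw]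
    cases b with
    | true =>
      change ∃ i' j' k' : ℕ, _ ∧ _ ∧ (conGen Rel).mk' xg * _ = _
      rcases hij.lt_or_eq with hlt | rfl
      · exact ⟨i + 1, j, k, hlt, hkj, by simp only [pow_succ', mul_assoc]⟩
      · exact ⟨i + 1, i + 1, k + 1, le_rfl, Nat.succ_le_succ hkj,
          (pow_succ_mul_pow_succ_mul_pow_succ hx commute_mk'_xs_mul_xg i k).symm⟩
    | false =>
      change ∃ i' j' k' : ℕ, _ ∧ _ ∧ (conGen Rel).mk' xs * _ = _
      cases i with
      | zero =>
        exact ⟨0, j + 1, k, Nat.zero_le _, hkj.trans j.le_succ,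
          by simp only [pow_zero, one_mul, pow_succ', mul_assoc]⟩
      | succ i =>
        exact ⟨i, j, k, (Nat.lt_of_succ_le hij).le, hkj, by
          rw [← mul_assoc, mul_pow_succ_mul_pow_of_lt hs commute_mk'_xs_mul_xg hij]⟩
end

section
/- Let R be a unital ring, n ≥ 2, and a, b ∈ R with a = a·b·a and b = b·a·b. Assume that for all 1 ≤ i ≤ n one has (1 − a^i b^i)(1 − b^i a^i) = 0 = (1 − b^i a^i)(1 − a^i b^i). Then: (1) a^i b^i and b^j a^j commute for all 1 ≤ i, j ≤ n; (2) a^i = a^i b^i a^i and b^i = b^i a^i b^i for all 1 ≤ i ≤ n (so all a^i b^i and b^j a^j are commuting idempotents), and (ab)(a²b²) = a²b², (a²b²)(a³b³) = a³b³, …, and similarly (ba)(b²a²) = b²a², etc.; (3) setting f_k = a^k(1 − ab)b^k and g_k = b^k(1 − ba)a^k for 0 ≤ k ≤ n−1: (3a) f₀, …, f_{n−1}, g₀, …, g_{n−1} are pairwise orthogonal idempotents; (3b) a·f_j·b = f_{j+1} and b·g_j·a = g_{j+1} for 0 ≤ j ≤ n−2; (3c) b·f_j·a = f_{j−1} and a·g_j·b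 = g_{j−1} for 1 ≤ j ≤ n−1; (3d) consecutive f_j are equivalent idempotents and consecutive g_j are equivalent idempotents, where idempotents e, f are equivalent if there exist u, v ∈ R with u·v = e and v·u = f. -/
/-- The pair `a, b` satisfies `a = aba`, `b = bab`, and the idempotents complementary to
`a ^ i * b ^ i` and `b ^ i * a ^ i` are orthogonal for `1 ≤ i ≤ n`. -/
structure IsOrthogonalPair {R : Type*} [Ring R] (n : ℕ) (a b : R) : Prop where
  left_regular : a * b * a = a
  right_regular : b * a * b = b
  left_orth : ∀ i : ℕ, 1 ≤ i → i ≤ n → (1 - a ^ i * b ^ i) * (1 - b ^ i * a ^ i) = 0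
  right_orth : ∀ i : ℕ, 1 ≤ i → i ≤ n → (1 - b ^ i * a ^ i) * (1 - a ^ i * b ^ i) = 0

namespace IsOrthogonalPair

variable {R : Type*} [Ring R] {n : ℕ} {a b : R}

theorem symm (h : IsOrthogonalPair n a b) : IsOrthogonalPair n b a :=
  ⟨h.right_regular, h.left_regular, h.right_orth, h.left_orth⟩

theorem one_sub_mul_one_sub (h : IsOrthogonalPair n a b) {i : ℕ} (hi : i ≤ n) :
    (1 - a ^ i * b ^ i) * (1 - b ^ i * a ^ i) = 0 := by
  rcases Nat.eq_zero_or_pos i with rfl | hpos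
  · simp
  · exact h.left_orth i hpos hi

theorem one_sub_mul_one_sub_base (h : IsOrthogonalPair n a b) {i : ℕ} (hi : i ≤ n) :
    (1 - a ^ i * b ^ i) * (1 - b * a) = 0 := by
  rcases Nat.eq_zero_or_pos i with rfl | hpos
  · simp
  · have hq : b ^ i * a ^ i * (b * a) = b ^ i * a ^ i := by
      obtain ⟨k, rfl⟩ : ∃ k, i = k + 1 := ⟨i - 1, by omega⟩
      calc b ^ (k + 1) * a ^ (k + 1) * (b * a) = b ^ (k + 1) * a ^ k * (a * b * a) := by
            rw [pow_succ a]; noncomm_ring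
        _ = b ^ (k + 1) * a ^ (k + 1) := by rw [h.left_regular, pow_succ a, mul_assoc]
    have hq' : (1 - b ^ i * a ^ i) * (1 - b * a) = 1 - b * a := by
      rw [mul_sub, sub_mul _ _ (b * a), hq]; simp
    rw [← hq', ← mul_assoc, h.one_sub_mul_one_sub hi, zero_mul]

theorem base_one_sub_mul_one_sub (h : IsOrthogonalPair n a b) {i : ℕ} (hi : i ≤ n) :
    (1 - b * a) * (1 - a ^ i * b ^ i) = 0 := by
  rcases Nat.eq_zero_or_pos i with rfl | hpos
  · simp
  · have hq : b * a * (b ^ i * a ^ i) = b ^ i * a ^ i := by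
      obtain ⟨k, rfl⟩ : ∃ k, i = k + 1 := ⟨i - 1, by omega⟩
      calc b * a * (b ^ (k + 1) * a ^ (k + 1)) = b * a * b * (b ^ k * a ^ (k + 1)) := by
            rw [pow_succ' b]; simp only [mul_assoc]
        _ = b ^ (k + 1) * a ^ (k + 1) := by rw [h.right_regular, pow_succ' b, mul_assoc]
    have hq' : (1 - b * a) * (1 - b ^ i * a ^ i) = 1 - b * a := by
      rw [mul_sub, sub_mul 1 _ (b ^ i * a ^ i), hq]; simp
    rw [← hq', mul_assoc, h.symm.one_sub_mul_one_sub hi, mul_zero]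

theorem mul_base (h : IsOrthogonalPair n a b) {i : ℕ} (hi : i ≤ n) :
    a ^ i * b ^ i * (b * a) = a ^ i * b ^ i + b * a - 1 := by
  have := h.one_sub_mul_one_sub_base hi
  rw [← sub_eq_zero, ← this]; noncomm_ring

theorem base_mul (h : IsOrthogonalPair n a b) {i : ℕ} (hi : i ≤ n) :
    b * a * (a ^ i * b ^ i) = a ^ i * b ^ i + b * a - 1 := by
  have := h.base_one_sub_mul_one_sub hi
  rw [← sub_eq_zero, ← this]; noncomm_ring

theorem pow_mul_pow_mul_pow (h : IsOrthogonalPair n a b) {i : ℕ} (hi : i ≤ n) :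
    a ^ i * b ^ i * a ^ i = a ^ i := by
  induction i with
  | zero => simp
  | succ k ih =>
    have hk : k ≤ n := by omega
    calc a ^ (k + 1) * b ^ (k + 1) * a ^ (k + 1)
        = a * (a ^ k * b ^ k * (b * a)) * a ^ k := by
          rw [pow_succ' a, pow_succ b]; simp only [mul_assoc]
      _ = a * b * a * (a ^ k * b ^ k * a ^ k) := by
          rw [h.mul_base hk, ← h.base_mul hk]; simp only [mul_assoc]
      _ = a ^ (k + 1) := by rw [ih hk, h.left_regular, pow_succ']

theorem mul_of_le (h : IsOrthogonalPair n a b) {i j : ℕ} (hij : i ≤ j) (hj : j ≤ n) :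
    a ^ i * b ^ i * (a ^ j * b ^ j) = a ^ j * b ^ j := by
  obtain ⟨k, rfl⟩ := Nat.exists_eq_add_of_le hij
  rw [pow_add a, ← mul_assoc, ← mul_assoc (a ^ i * b ^ i),
    h.pow_mul_pow_mul_pow (hij.trans hj)]

theorem mul_of_ge (h : IsOrthogonalPair n a b) {i j : ℕ} (hij : i ≤ j) (hj : j ≤ n) :
    a ^ j * b ^ j * (a ^ i * b ^ i) = a ^ j * b ^ j := by
  obtain ⟨k, rfl⟩ := Nat.exists_eq_add_of_le' hij
  rw [pow_add b, mul_assoc, mul_assoc (b ^ k), ← mul_assoc (b ^ i),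
    h.symm.pow_mul_pow_mul_pow (hij.trans hj)]

theorem one_sub_mul_one_sub_of_le (h : IsOrthogonalPair n a b) {i j : ℕ} (hi : i ≤ n)
    (hj : j ≤ n) : (1 - a ^ i * b ^ i) * (1 - b ^ j * a ^ j) = 0 := by
  rcases le_total i j with hij | hij
  · have hp : (1 - a ^ i * b ^ i) * (1 - a ^ j * b ^ j) = 1 - a ^ i * b ^ i := by
      rw [mul_sub, sub_mul _ _ (a ^ j * b ^ j), h.mul_of_le hij hj]; simp
    rw [← hp, mul_assoc, h.one_sub_mul_one_sub hj, mul_zero]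
  · have hq : (1 - b ^ i * a ^ i) * (1 - b ^ j * a ^ j) = 1 - b ^ j * a ^ j := by
      rw [mul_sub, sub_mul _ _ (b ^ j * a ^ j), h.symm.mul_of_ge hij hi]; simp
    rw [← hq, ← mul_assoc, h.one_sub_mul_one_sub hi, zero_mul]

theorem mul_eq_add_sub_one (h : IsOrthogonalPair n a b) {i j : ℕ} (hi : i ≤ n) (hj : j ≤ n) :
    a ^ i * b ^ i * (b ^ j * a ^ j) = a ^ i * b ^ i + b ^ j * a ^ j - 1 := by
  have := h.one_sub_mul_one_sub_of_le hi hj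
  rw [← sub_eq_zero, ← this]; noncomm_ring

theorem commute (h : IsOrthogonalPair n a b) {i j : ℕ} (hi : i ≤ n) (hj : j ≤ n) :
    a ^ i * b ^ i * (b ^ j * a ^ j) = b ^ j * a ^ j * (a ^ i * b ^ i) := by
  rw [h.mul_eq_add_sub_one hi hj, h.symm.mul_eq_add_sub_one hj hi, add_comm (a ^ i * b ^ i)]

theorem idempotent (h : IsOrthogonalPair n a b) {i : ℕ} (hi : i ≤ n) :
    a ^ i * b ^ i * (a ^ i * b ^ i) = a ^ i * b ^ i :=
  h.mul_of_le le_rfl hi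

end IsOrthogonalPair

/-- The difference `a ^ k * b ^ k - a ^ (k + 1) * b ^ (k + 1)`, in factored form. -/
def powGap {R : Type*} [Ring R] (a b : R) (k : ℕ) : R :=
  a ^ k * (1 - a * b) * b ^ k

theorem powGap_eq_sub {R : Type*} [Ring R] (a b : R) (k : ℕ) :
    powGap a b k = a ^ k * b ^ k - a ^ (k + 1) * b ^ (k + 1) := by
  rw [powGap, pow_succ a, pow_succ' b]; simp only [mul_sub, sub_mul, mul_one, mul_assoc]

theorem mul_powGap_mul {R : Type*} [Ring R] (a b : R) (k : ℕ) :
    a * powGap a b k * b = powGap a b (k + 1) := by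
  rw [powGap, powGap, pow_succ' a, pow_succ b]; simp only [mul_assoc]

namespace IsOrthogonalPair

variable {R : Type*} [Ring R] {n : ℕ} {a b : R}

theorem powGap_mul_self (h : IsOrthogonalPair n a b) {j : ℕ} (hj : j < n) :
    powGap a b j * powGap a b j = powGap a b j := by
  simp only [powGap_eq_sub, mul_sub, sub_mul, h.idempotent hj.le, h.idempotent hj,
    h.mul_of_le j.le_succ hj, h.mul_of_ge j.le_succ hj]
  abel

theorem powGap_mul_of_ne (h : IsOrthogonalPair n a b) {j k : ℕ} (hj : j < n) (hk : k < n)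
    (hjk : j ≠ k) : powGap a b j * powGap a b k = 0 := by
  rcases lt_or_gt_of_ne hjk with hlt | hlt
  · simp only [powGap_eq_sub, mul_sub, sub_mul, h.mul_of_le hlt.le hk.le,
      h.mul_of_le hlt hk.le, h.mul_of_le (hlt.le.trans k.le_succ) hk,
      h.mul_of_le (Nat.succ_le_succ hlt.le) hk]
    abel
  · simp only [powGap_eq_sub, mul_sub, sub_mul, h.mul_of_ge hlt.le hj.le,
      h.mul_of_ge hlt hj.le, h.mul_of_ge (hlt.le.trans j.le_succ) hj,
      h.mul_of_ge (Nat.succ_le_succ hlt.le) hj]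
    abel

theorem powGap_mul_powGap_swap (h : IsOrthogonalPair n a b) {j k : ℕ} (hj : j < n)
    (hk : k < n) : powGap a b j * powGap b a k = 0 := by
  simp only [powGap_eq_sub, mul_sub, sub_mul, h.mul_eq_add_sub_one hj.le hk.le,
    h.mul_eq_add_sub_one hj.le hk, h.mul_eq_add_sub_one hj hk.le, h.mul_eq_add_sub_one hj hk]
  abel

theorem base_mul_powGap (h : IsOrthogonalPair n a b) {j : ℕ} (hj : j < n) :
    b * a * powGap a b j = powGap a b j := by
  rw [powGap_eq_sub, mul_sub, h.base_mul hj.le, h.base_mul hj]; abel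

theorem powGap_mul_base (h : IsOrthogonalPair n a b) {j : ℕ} (hj : j < n) :
    powGap a b j * (b * a) = powGap a b j := by
  rw [powGap_eq_sub, sub_mul, h.mul_base hj.le, h.mul_base hj]; abel

theorem mul_powGap_succ_mul (h : IsOrthogonalPair n a b) {j : ℕ} (hj : j < n) :
    b * powGap a b (j + 1) * a = powGap a b j := by
  calc b * powGap a b (j + 1) * a = b * a * powGap a b j * (b * a) := by
        rw [← mul_powGap_mul]; simp only [mul_assoc]
    _ = powGap a b j := by rw [h.base_mul_powGap hj, h.powGap_mul_base hj]

theorem exists_powGap_equiv (h : IsOrthogonalPair n a b) {j : ℕ} (hj : j < n) :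
    ∃ u v : R, u * v = powGap a b j ∧ v * u = powGap a b (j + 1) := by
  refine ⟨powGap a b j * b, a * powGap a b j, ?_, ?_⟩
  · rw [mul_assoc, ← mul_assoc b, h.base_mul_powGap hj, h.powGap_mul_self hj]
  · rw [mul_assoc, ← mul_assoc (powGap a b j), h.powGap_mul_self hj, ← mul_assoc,
      mul_powGap_mul]

end IsOrthogonalPair

/-- Lemma 5.5 of the paper: consequences of the orthogonality relations
`(1 − a^i b^i)(1 − b^i a^i) = 0 = (1 − b^i a^i)(1 − a^i b^i)` for `1 ≤ i ≤ n`
for elements `a, b` of a unital ring with `a = aba`, `b = bab`. -/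
theorem stmt2 {R : Type*} [Ring R] (n : ℕ) (hn : 2 ≤ n) (a b : R)
    (ha : a * b * a = a) (hb : b * a * b = b)
    (horth : ∀ i : ℕ, 1 ≤ i → i ≤ n →
      (1 - a ^ i * b ^ i) * (1 - b ^ i * a ^ i) = 0 ∧
      (1 - b ^ i * a ^ i) * (1 - a ^ i * b ^ i) = 0) :
    -- (1) the idempotents `a^i b^i` and `b^j a^j` commute
    (∀ i j : ℕ, 1 ≤ i → i ≤ n → 1 ≤ j → j ≤ n →
      (a ^ i * b ^ i) * (b ^ j * a ^ j) = (b ^ j * a ^ j) * (a ^ i * b ^ i)) ∧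
    -- (2) `a^i = a^i b^i a^i` and `b^i = b^i a^i b^i`; in particular `a^i b^i` and
    -- `b^j a^j` are commuting idempotents, and the chains decrease
    (∀ i : ℕ, 1 ≤ i → i ≤ n →
      a ^ i * b ^ i * a ^ i = a ^ i ∧ b ^ i * a ^ i * b ^ i = b ^ i ∧
      (a ^ i * b ^ i) * (a ^ i * b ^ i) = a ^ i * b ^ i ∧
      (b ^ i * a ^ i) * (b ^ i * a ^ i) = b ^ i * a ^ i) ∧
    (∀ i : ℕ, 1 ≤ i → i + 1 ≤ n →
      (a ^ i * b ^ i) * (a ^ (i + 1) * b ^ (i + 1)) = a ^ (i + 1) * b ^ (i + 1) ∧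
      (a ^ (i + 1) * b ^ (i + 1)) * (a ^ i * b ^ i) = a ^ (i + 1) * b ^ (i + 1) ∧
      (b ^ i * a ^ i) * (b ^ (i + 1) * a ^ (i + 1)) = b ^ (i + 1) * a ^ (i + 1) ∧
      (b ^ (i + 1) * a ^ (i + 1)) * (b ^ i * a ^ i) = b ^ (i + 1) * a ^ (i + 1)) ∧
    -- (3) properties of `f_k = a^k (1 − ab) b^k` and `g_k = b^k (1 − ba) a^k`
    (∀ f g : ℕ → R,
      (∀ k : ℕ, f k = a ^ k * (1 - a * b) * b ^ k) →
      (∀ k : ℕ, g k = b ^ k * (1 - b * a) * a ^ k) →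
      -- (3a) pairwise orthogonal idempotents
      ((∀ j : ℕ, j ≤ n - 1 → f j * f j = f j ∧ g j * g j = g j) ∧
       (∀ j k : ℕ, j ≤ n - 1 → k ≤ n - 1 → j ≠ k → f j * f k = 0 ∧ g j * g k = 0) ∧
       (∀ j k : ℕ, j ≤ n - 1 → k ≤ n - 1 → f j * g k = 0 ∧ g k * f j = 0)) ∧
      -- (3b)
      (∀ j : ℕ, j ≤ n - 2 → a * f j * b = f (j + 1) ∧ b * g j * a = g (j + 1)) ∧
      -- (3c)
      (∀ j : ℕ, 1 ≤ j → j ≤ n - 1 → b * f j * a = f (j - 1) ∧ a * g j * b = g (j - 1)) ∧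
      -- (3d) consecutive `f_j`'s (resp. `g_j`'s) are equivalent idempotents
      (∀ j : ℕ, 1 ≤ j → j ≤ n - 1 →
        (∃ u v : R, u * v = f (j - 1) ∧ v * u = f j) ∧
        (∃ u v : R, u * v = g (j - 1) ∧ v * u = g j))) := by
  have h : IsOrthogonalPair n a b :=
    ⟨ha, hb, fun i h1 h2 => (horth i h1 h2).1, fun i h1 h2 => (horth i h1 h2).2⟩
  refine ⟨fun i j _ hi _ hj => h.commute hi hj, fun i _ hi => ⟨h.pow_mul_pow_mul_pow hi,
    h.symm.pow_mul_pow_mul_pow hi, h.idempotent hi, h.symm.idempotent hi⟩,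
    fun i _ hi => ⟨h.mul_of_le i.le_succ hi, h.mul_of_ge i.le_succ hi,
      h.symm.mul_of_le i.le_succ hi, h.symm.mul_of_ge i.le_succ hi⟩, ?_⟩
  intro f g hf hg
  obtain rfl : f = powGap a b := funext hf
  obtain rfl : g = powGap b a := funext hg
  have lt_of_le_pred {j : ℕ} (hj : j ≤ n - 1) : j < n := by omega
  refine ⟨⟨fun j hj => ?_, fun j k hj hk hjk => ?_, fun j k hj hk => ?_⟩,
    fun j _ => ⟨mul_powGap_mul a b j, mul_powGap_mul b a j⟩, fun j h1 hj => ?_,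
    fun j h1 hj => ?_⟩
  · exact ⟨h.powGap_mul_self (lt_of_le_pred hj), h.symm.powGap_mul_self (lt_of_le_pred hj)⟩
  · exact ⟨h.powGap_mul_of_ne (lt_of_le_pred hj) (lt_of_le_pred hk) hjk,
      h.symm.powGap_mul_of_ne (lt_of_le_pred hj) (lt_of_le_pred hk) hjk⟩
  · exact ⟨h.powGap_mul_powGap_swap (lt_of_le_pred hj) (lt_of_le_pred hk),
      h.symm.powGap_mul_powGap_swap (lt_of_le_pred hk) (lt_of_le_pred hj)⟩
  · obtain ⟨i, rfl⟩ := Nat.exists_eq_add_of_le' h1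
    have hi : i < n := by omega
    exact ⟨h.mul_powGap_succ_mul hi, h.symm.mul_powGap_succ_mul hi⟩
  · obtain ⟨i, rfl⟩ := Nat.exists_eq_add_of_le' h1
    have hi : i < n := by omega
    exact ⟨h.exists_powGap_equiv hi, h.symm.exists_powGap_equiv hi⟩
end

section
/- Let R be a *-regular ring and S a *-subring of R (a subring closed under the involution). Define an increasing chain of *-subrings of R by 𝓡₀ = S and, inductively, 𝓡_{i+1} = the subring of R generated by 𝓡_i together with the relative inverses in R of all elements of 𝓡_i. Then the union 𝓡 = ⋃_{i≥0} 𝓡_i is a *-regular subring of R containing S (i.e., it is closed under the involution and is itself a von Neumann regular ring), and 𝓡 is contained in every *-regular subring of R containing S; hence 𝓡 is the smallest *-regular subring of R containing S. -/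
/- The *-regular closure of a *-subring of a *-regular ring (Proposition 5.2 of the paper). -/

namespace StarRegularClosure

/-- `b` is the relative inverse of `a`: `aba = a`, `bab = b`, and `ab`, `ba` are
self-adjoint. In a *-regular ring such a `b` exists and is unique. -/
def IsRelInv {R : Type*} [Ring R] [StarRing R] (a b : R) : Prop :=
  a * b * a = a ∧ b * a * b = b ∧ star (a * b) = a * b ∧ star (b * a) = b * a

/-- the increasing chain of subrings: `𝓡₀ = S`, and `𝓡_{i+1}` is the subring generated by
`𝓡_i` together with the relative inverses in `R` of the elements of `𝓡_i`. -/
def chain {R : Type*} [Ring R] [StarRing R] (S : Subring R) : ℕ → Subring R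
  | 0 => S
  | (i + 1) =>
      Subring.closure ((chain S i : Set R) ∪ {b : R | ∃ a ∈ chain S i, IsRelInv a b})

end StarRegularClosure

namespace StarRegularClosure

section RelInv

variable {R : Type*} [Ring R] [StarRing R]

theorem IsRelInv.star {a b : R} (h : IsRelInv a b) : IsRelInv (star a) (star b) := by
  obtain ⟨h1, h2, h3, h4⟩ := h
  refine ⟨?_, ?_, ?_, ?_⟩
  · simpa [mul_assoc] using congrArg Star.star h1
  · simpa [mul_assoc] using congrArg Star.star h2
  · rw [← star_mul, h4, h4]
  · rw [← star_mul, h3, h3]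

theorem IsRelInv.unique {a b c : R} (hb : IsRelInv a b) (hc : IsRelInv a c) : b = c := by
  obtain ⟨b1, b2, b3, b4⟩ := hb
  obtain ⟨c1, c2, c3, c4⟩ := hc
  have hl : a * b = a * c := by
    calc a * b = Star.star (a * c * (a * b)) := by rw [← mul_assoc, c1, b3]
      _ = a * b * (a * c) := by rw [star_mul, b3, c3]
      _ = a * c := by rw [← mul_assoc, b1]
  have hr : b * a = c * a := by
    calc b * a = Star.star (b * a * (c * a)) := by
          rw [mul_assoc b, ← mul_assoc a, c1, b4]
      _ = c * a * (b * a) := by rw [star_mul, b4, c4]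
      _ = c * a := by rw [mul_assoc c, ← mul_assoc a, b1]
  calc b = b * a * b := b2.symm
    _ = c * (a * b) := by rw [hr, mul_assoc]
    _ = c := by rw [hl, ← mul_assoc, c2]

/-- In a *-regular subring `T`, every `a` has an inner inverse `c` with `a * c` self-adjoint. -/
theorem exists_inner_inverse_star_mul_eq (hproper : ∀ x : R, star x * x = 0 → x = 0)
    {T : Subring R} (hT : ∀ x ∈ T, star x ∈ T) (hreg : ∀ a ∈ T, ∃ b ∈ T, a * b * a = a)
    {a : R} (ha : a ∈ T) : ∃ c ∈ T, a * c * a = a ∧ star (a * c) = a * c := by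
  obtain ⟨x, hx, h⟩ := hreg _ (T.mul_mem (hT a ha) ha)
  have h0 : a * (x * star a) * a = a := by
    refine sub_eq_zero.mp (hproper _ ?_)
    have h1 : star a * (a * (x * star a) * a - a) = 0 := by
      rw [mul_sub, sub_eq_zero]
      simpa only [mul_assoc] using h
    have h2 : a * (x * star a) * a - a = a * (x * star a * a - 1) := by noncomm_ring
    conv_lhs => rw [h2, star_mul, ← h2, mul_assoc, h1, mul_zero]
  have h3 : a * (x * star a) * star (a * (x * star a)) = star (a * (x * star a)) := by
    have h4 : star (a * (x * star a)) = a * (star x * star a) := by simp [mul_assoc]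
    rw [h4, ← mul_assoc _ a, h0]
  refine ⟨x * star a, T.mul_mem hx (hT a ha), h0, ?_⟩
  have h5 := congrArg star h3
  rw [star_mul, star_star, h3] at h5
  exact h5

theorem exists_isRelInv_mem (hproper : ∀ x : R, star x * x = 0 → x = 0)
    {T : Subring R} (hT : ∀ x ∈ T, star x ∈ T) (hreg : ∀ a ∈ T, ∃ b ∈ T, a * b * a = a)
    {a : R} (ha : a ∈ T) : ∃ b ∈ T, IsRelInv a b := by
  obtain ⟨c, hc, c1, c2⟩ := exists_inner_inverse_star_mul_eq hproper hT hreg ha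
  obtain ⟨d, hd, d1, d2⟩ := exists_inner_inverse_star_mul_eq hproper hT hreg (hT a ha)
  have e1 : a * star d * a = a := by simpa [mul_assoc] using congrArg star d1
  have e2 : star (star d * a) = star d * a := by simpa using d2.symm
  have hl : a * (star d * a * c) = a * c := by rw [← mul_assoc, ← mul_assoc, e1]
  have hr : star d * a * c * a = star d * a := by rw [mul_assoc, mul_assoc, ← mul_assoc a, c1]
  refine ⟨star d * a * c, T.mul_mem (T.mul_mem (hT d hd) ha) hc, ?_, ?_, ?_, ?_⟩
  · rw [hl, c1]
  · rw [hr, mul_assoc, hl, ← mul_assoc]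
  · rw [hl, c2]
  · rw [hr, e2]

end RelInv

section Chain

variable {R : Type*} [Ring R] [StarRing R] {S : Subring R}

theorem chain_monotone : Monotone (chain S) :=
  monotone_nat_of_le_succ fun _ _ hx => Subring.subset_closure (Or.inl hx)

theorem IsRelInv.mem_chain_succ {a b : R} (h : IsRelInv a b) {i : ℕ} (ha : a ∈ chain S i) :
    b ∈ chain S (i + 1) :=
  Subring.subset_closure (Or.inr ⟨a, ha, h⟩)

theorem star_mem_chain (hS : ∀ x ∈ S, star x ∈ S) (i : ℕ) :
    ∀ x ∈ chain S i, star x ∈ chain S i := by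
  induction i with
  | zero => exact hS
  | succ i ih =>
    intro x hx
    refine Subring.closure_induction (p := fun x _ => star x ∈ chain S (i + 1))
      ?_ ?_ ?_ ?_ ?_ ?_ hx
    · rintro x (hx | ⟨a, ha, hb⟩)
      · exact chain_monotone i.le_succ (ih x hx)
      · exact hb.star.mem_chain_succ (ih a ha)
    · simp
    · simp
    · intro x y _ _ hx hy
      simpa using add_mem hx hy
    · intro x _ hx
      simpa using hx
    · intro x y _ _ hx hy
      simpa using mul_mem hy hx

theorem chain_le (hproper : ∀ x : R, star x * x = 0 → x = 0)
    {T : Subring R} (hT : ∀ x ∈ T, star x ∈ T) (hreg : ∀ a ∈ T, ∃ b ∈ T, a * b * a = a)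
    (hST : S ≤ T) (i : ℕ) : chain S i ≤ T := by
  induction i with
  | zero => exact hST
  | succ i ih =>
    refine Subring.closure_le.mpr ?_
    rintro x (hx | ⟨a, ha, hx⟩)
    · exact ih hx
    · obtain ⟨b, hbT, hb⟩ := exists_isRelInv_mem hproper hT hreg (ih ha)
      exact hx.unique hb ▸ hbT

end Chain

end StarRegularClosure

open StarRegularClosure in
/-- Let `R` be a *-regular ring and `S` a *-subring.  Then the union of the chain
`𝓡₀ ⊆ 𝓡₁ ⊆ ⋯` is the smallest *-regular subring of `R` containing `S`. -/
theorem stmt3 {R : Type*} [Ring R] [StarRing R]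
    (hreg : ∀ a : R, ∃ b : R, a * b * a = a)
    (hproper : ∀ x : R, star x * x = 0 → x = 0)
    (S : Subring R) (hS : ∀ x ∈ S, star x ∈ S) :
    ∃ calR : Subring R,
      (calR : Set R) = ⋃ i : ℕ, (chain S i : Set R) ∧
      (∀ x ∈ calR, star x ∈ calR) ∧
      (∀ a ∈ calR, ∃ b ∈ calR, a * b * a = a) ∧
      S ≤ calR ∧
      ∀ T : Subring R, (∀ x ∈ T, star x ∈ T) → (∀ a ∈ T, ∃ b ∈ T, a * b * a = a) →
        S ≤ T → calR ≤ T := by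
  have hdir : Directed (· ≤ ·) (chain S) := chain_monotone.directed_le
  refine ⟨⨆ i, chain S i, Subring.coe_iSup_of_directed hdir, ?_, ?_, le_iSup (chain S) 0, ?_⟩
  · intro x hx
    obtain ⟨i, hi⟩ := (Subring.mem_iSup_of_directed hdir).mp hx
    exact (Subring.mem_iSup_of_directed hdir).mpr ⟨i, star_mem_chain hS i x hi⟩
  · intro a ha
    obtain ⟨i, hi⟩ := (Subring.mem_iSup_of_directed hdir).mp ha
    obtain ⟨b, -, hb⟩ := exists_isRelInv_mem hproper (T := ⊤) (fun _ _ => Subring.mem_top _)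
      (fun a _ => (hreg a).imp fun _ h => ⟨Subring.mem_top _, h⟩) (Subring.mem_top a)
    exact ⟨b, (Subring.mem_iSup_of_directed hdir).mpr ⟨i + 1, hb.mem_chain_succ hi⟩, hb.1⟩
  · intro T hT hTreg hST
    exact iSup_le (chain_le hproper hT hTreg hST)
end

section
/- Let R be a *-regular ring and let (R_i)_{i∈I} be any family of *-regular subrings of R. Then the intersection ⋂_{i∈I} R_i is again a *-regular subring of R; in particular it is a von Neumann regular ring. -/
/-- `b` is a relative (Moore-Penrose) inverse of `a`. -/
structure IsRelativeInverse {R : Type*} [Ring R] [StarRing R] (a b : R) : Prop where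
  mul_mul_left : a * b * a = a
  mul_mul_right : b * a * b = b
  star_left : star (a * b) = a * b
  star_right : star (b * a) = b * a

theorem IsRelativeInverse.unique {R : Type*} [Ring R] [StarRing R] {a b c : R}
    (hb : IsRelativeInverse a b) (hc : IsRelativeInverse a c) : b = c := by
  have hl : a * b = a * c := by
    calc a * b = star (a * c * a * b) := by rw [hc.mul_mul_left, hb.star_left]
      _ = star (a * b) * star (a * c) := by rw [← star_mul, ← mul_assoc]
      _ = a * b * a * c := by rw [hb.star_left, hc.star_left, ← mul_assoc]
      _ = a * c := by rw [hb.mul_mul_left]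
  have hr : b * a = c * a := by
    calc b * a = star (b * (a * c * a)) := by rw [hc.mul_mul_left, hb.star_right]
      _ = star (c * a) * star (b * a) := by rw [← star_mul]; simp only [mul_assoc]
      _ = c * (a * b * a) := by rw [hb.star_right, hc.star_right]; simp only [mul_assoc]
      _ = c * a := by rw [hb.mul_mul_left]
  rw [← hb.mul_mul_right, hr, mul_assoc, hl, ← mul_assoc, hc.mul_mul_right]

theorem exists_mem_inner_inverse_star_mul_eq {R : Type*} [Ring R] [StarRing R]
    (hproper : ∀ x : R, star x * x = 0 → x = 0) (S : Subring R)
    (hstar : ∀ x ∈ S, star x ∈ S) (hreg : ∀ a ∈ S, ∃ b ∈ S, a * b * a = a)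
    {a : R} (ha : a ∈ S) : ∃ b ∈ S, a * b * a = a ∧ star (a * b) = a * b := by
  obtain ⟨x, hx, hax⟩ := hreg (star a * a) (S.mul_mem (hstar a ha) ha)
  have h : a * (x * star a) * a = a := by
    refine sub_eq_zero.mp (hproper _ ?_)
    calc star (a * (x * star a) * a - a) * (a * (x * star a) * a - a)
        = star (x * (star a * a) - 1) * (star a * a * x * (star a * a) - star a * a) := by
          rw [show a * (x * star a) * a - a = a * (x * (star a * a) - 1) by noncomm_ring,
            star_mul]
          noncomm_ring
      _ = 0 := by rw [hax, sub_self, mul_zero]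
  refine ⟨x * star a, S.mul_mem hx (hstar a ha), h, ?_⟩
  have hp : a * (x * star a) = a * (x * star a) * star (a * (x * star a)) := by
    have h' := congrArg star h
    rw [star_mul] at h'
    calc a * (x * star a) = a * (x * (star a * star (a * (x * star a)))) := by rw [h']
      _ = _ := by simp only [mul_assoc]
  rw [hp, star_mul, star_star]

theorem exists_mem_isRelativeInverse {R : Type*} [Ring R] [StarRing R]
    (hproper : ∀ x : R, star x * x = 0 → x = 0) (S : Subring R)
    (hstar : ∀ x ∈ S, star x ∈ S) (hreg : ∀ a ∈ S, ∃ b ∈ S, a * b * a = a)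
    {a : R} (ha : a ∈ S) : ∃ b ∈ S, IsRelativeInverse a b := by
  obtain ⟨b, hb, hab, hsb⟩ := exists_mem_inner_inverse_star_mul_eq hproper S hstar hreg ha
  obtain ⟨d, hd, had, hsd⟩ :=
    exists_mem_inner_inverse_star_mul_eq hproper S hstar hreg (hstar a ha)
  have hac : a * star d * a = a := by
    simpa [mul_assoc] using congrArg star had
  have hsc : star (star d * a) = star d * a := by
    simpa using hsd.symm
  have hl : a * (star d * a * b) = a * b := by
    rw [← mul_assoc, ← mul_assoc, hac]
  have hr : star d * a * b * a = star d * a := by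
    rw [mul_assoc, mul_assoc, ← mul_assoc a, hab]
  refine ⟨star d * a * b, S.mul_mem (S.mul_mem (hstar d hd) ha) hb, ?_, ?_, ?_, ?_⟩
  · rw [hl, hab]
  · rw [hr, mul_assoc, hl, ← mul_assoc]
  · rw [hl, hsb]
  · rw [hr, hsc]

/-- Any intersection of *-regular subrings of a *-regular ring `R` is again a *-regular
subring; in particular it is von Neumann regular. -/
theorem stmt4 {R : Type*} [Ring R] [StarRing R]
    (hreg : ∀ a : R, ∃ b : R, a * b * a = a)
    (hproper : ∀ x : R, star x * x = 0 → x = 0)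
    {ι : Type*} (Rf : ι → Subring R)
    (hstar : ∀ i : ι, ∀ x ∈ Rf i, star x ∈ Rf i)
    (hregi : ∀ i : ι, ∀ a ∈ Rf i, ∃ b ∈ Rf i, a * b * a = a) :
    (∀ x ∈ ⨅ i : ι, Rf i, star x ∈ ⨅ i : ι, Rf i) ∧
    (∀ a ∈ ⨅ i : ι, Rf i, ∃ b ∈ ⨅ i : ι, Rf i, a * b * a = a) := by
  refine ⟨fun x hx => ?_, fun a ha => ?_⟩
  · rw [Subring.mem_iInf] at hx ⊢
    exact fun i => hstar i x (hx i)
  · rw [Subring.mem_iInf] at ha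
    obtain ⟨b, -, hb⟩ := exists_mem_isRelativeInverse hproper ⊤ (fun _ _ => Subring.mem_top _)
      (fun a _ => (hreg a).imp fun b h => ⟨Subring.mem_top b, h⟩) (Subring.mem_top a)
    refine ⟨b, Subring.mem_iInf.mpr fun i => ?_, hb.mul_mul_left⟩
    obtain ⟨c, hc, hac⟩ :=
      exists_mem_isRelativeInverse hproper (Rf i) (hstar i) (hregi i) (ha i)
    exact hb.unique hac ▸ hc
end

section
/- With the matrices wₙ, wₙ* ∈ Mₙ(F) of the construction: (a) wₙ·wₙ*·wₙ = wₙ and wₙ*·wₙ·wₙ* = wₙ* for all n ≥ 1; (b) 1 − wₙwₙ* and 1 − wₙ*wₙ are idempotent matrices of rank one, and they are orthogonal for each n ≥ 2; (c) for all 0 ≤ l ≤ i there exists n₀ such that (wₙ*)^l·wₙ^i·(1 − wₙwₙ*) = wₙ^{i−l}·(1 − wₙwₙ*) for all n ≥ n₀; (d) for all 0 ≤ i < l, (wₙ*)^l·wₙ^i·(1 − wₙwₙ*) = 0 for all sufficiently large n; (e) for all 0 ≤ l ≤ j, (1 − wₙwₙ*)·(wₙ*)^j·wₙ^l = (1 −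 wₙwₙ*)·(wₙ*)^{j−l} for all sufficiently large n; (f) for all 0 ≤ j < l, (1 − wₙwₙ*)·(wₙ*)^j·wₙ^l = 0 for all sufficiently large n. -/
open Polynomial

namespace SkewConstruction

/-- the lower shift matrix `wₙ = ∑_{i=1}^{n-1} e_{i+1,i}` of size `n` (`w₁ = 0`). -/
def wmat (F : Type*) [Field F] (n : ℕ) : Matrix (Fin n) (Fin n) F :=
  Matrix.of fun (a b : Fin n) => if (a : ℕ) = (b : ℕ) + 1 then (1 : F) else 0

/-- `F_k = f₀ f₁ ⋯ f_k`. -/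
noncomputable def Fk {F : Type*} [Field F] (f : ℕ → F[X]) (k : ℕ) : F[X] :=
  ∏ m ∈ Finset.range (k + 1), f m

/-- `N(k)`, the degree of `F_k`. -/
noncomputable def Nk {F : Type*} [Field F] (f : ℕ → F[X]) (k : ℕ) : ℕ :=
  (Fk f k).natDegree

/-- for `n ≥ M 1`, the unique `k ≥ 1` with `M k ≤ n < M (k+1)`. -/
def kidx (M : ℕ → ℕ) (n : ℕ) : ℕ :=
  Nat.findGreatest (fun k => M k ≤ n) n

/-- the matrix `wₙ*` of the construction: for `n < M(1)` it is the upper shift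
`∑_{i=1}^{n-1} e_{i,i+1}`; for `M(k) ≤ n < M(k+1)` (`k ≥ 1`) one subtracts
`∑_{j=1}^{N(k)} a_{k,j} (e_{j,1} + e_{n,n-j+1})`, where `a_{k,j}` is the `j`-th
coefficient of `F_k` (written here via `Polynomial.coeff`, which vanishes beyond the
degree `N(k)`). -/
noncomputable def wstarmat {F : Type*} [Field F] (f : ℕ → F[X]) (M : ℕ → ℕ) (n : ℕ) :
    Matrix (Fin n) (Fin n) F :=
  (Matrix.of fun (a b : Fin n) => if (b : ℕ) = (a : ℕ) + 1 then (1 : F) else 0) -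
    (if M 1 ≤ n then
      (Matrix.of fun (a b : Fin n) =>
        (if (b : ℕ) = 0 then (Fk f (kidx M n)).coeff ((a : ℕ) + 1) else 0) +
        (if (a : ℕ) = n - 1 then (Fk f (kidx M n)).coeff (n - (b : ℕ)) else 0))
    else 0)

open Matrix

section RingIdentities

variable {R : Type*} [Ring R] {w s : R}

theorem pow_mul_pow_mul_eq {x : R} {i : ℕ}
    (h : ∀ k < i, (1 - s * w) * (w ^ k * x) = 0) {l : ℕ} (hl : l ≤ i) :
    s ^ l * w ^ i * x = w ^ (i - l) * x := by
  induction l with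
  | zero => simp
  | succ l ih =>
    have hk := h (i - (l + 1)) (by omega)
    rw [sub_mul, one_mul, sub_eq_zero] at hk
    rw [pow_succ', mul_assoc, mul_assoc, ← mul_assoc (s ^ l), ih (by omega),
      show i - l = i - (l + 1) + 1 by omega, pow_succ', hk]
    simp only [mul_assoc]

theorem mul_pow_mul_pow_eq {x : R} {j : ℕ}
    (h : ∀ k < j, x * s ^ k * (1 - s * w) = 0) {l : ℕ} (hl : l ≤ j) :
    x * s ^ j * w ^ l = x * s ^ (j - l) := by
  induction l with
  | zero => simp
  | succ l ih =>
    have hk := h (j - (l + 1)) (by omega)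
    rw [mul_sub, mul_one, sub_eq_zero] at hk
    rw [pow_succ, ← mul_assoc, ih (by omega),
      show j - l = j - (l + 1) + 1 by omega, pow_succ, hk]
    simp only [mul_assoc]

end RingIdentities

section Shift

variable {F : Type*} [Field F] {m : ℕ}

theorem wmat_mul_zero (A : Matrix (Fin (m + 1)) (Fin (m + 1)) F) (b : Fin (m + 1)) :
    (wmat F (m + 1) * A) 0 b = 0 := by
  simp [mul_apply, wmat]

theorem wmat_mul_succ (A : Matrix (Fin (m + 1)) (Fin (m + 1)) F) (a : Fin m) (b : Fin (m + 1)) :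
    (wmat F (m + 1) * A) a.succ b = A a.castSucc b := by
  rw [mul_apply, Finset.sum_eq_single a.castSucc] <;> simp [wmat, Fin.ext_iff]
  intro x hx hx'
  omega

theorem mul_wmat_last (A : Matrix (Fin (m + 1)) (Fin (m + 1)) F) (a : Fin (m + 1)) :
    (A * wmat F (m + 1)) a (Fin.last m) = 0 := by
  rw [mul_apply]
  refine Finset.sum_eq_zero fun x _ => ?_
  have : (x : ℕ) ≠ m + 1 := by omega
  simp [wmat, this]

theorem mul_wmat_castSucc (A : Matrix (Fin (m + 1)) (Fin (m + 1)) F) (a : Fin (m + 1))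
    (b : Fin m) : (A * wmat F (m + 1)) a b.castSucc = A a b.succ := by
  rw [mul_apply, Finset.sum_eq_single b.succ] <;> simp [wmat, Fin.ext_iff]
  intro x hx hx'
  omega

variable (F m) in
theorem single_zero_vecMul_wmat : Pi.single 0 1 ᵥ* wmat F (m + 1) = 0 := by
  ext b
  simp [wmat]

theorem wmat_mulVec_succ (x : Fin (m + 1) → F) (a : Fin m) :
    (wmat F (m + 1) *ᵥ x) a.succ = x a.castSucc := by
  rw [mulVec, dotProduct, Finset.sum_eq_single a.castSucc] <;> simp [wmat, Fin.ext_iff]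
  intro x hx hx'
  omega

theorem wmat_mulVec_zero (x : Fin (m + 1) → F) : (wmat F (m + 1) *ᵥ x) 0 = 0 := by
  simp [mulVec, dotProduct, wmat]

/-- Multiplying by powers of the shift moves the support of a vector downwards. -/
theorem wmat_pow_mulVec_eq_zero {x : Fin (m + 1) → F} {N : ℕ}
    (hx : ∀ a : Fin (m + 1), N < a → x a = 0) (i : ℕ) (a : Fin (m + 1)) (ha : N + i < a) :
    (wmat F (m + 1) ^ i *ᵥ x) a = 0 := by
  induction i generalizing a with
  | zero => simpa using hx a ha
  | succ i ih =>
    rw [pow_succ', ← mulVec_mulVec]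
    cases a using Fin.cases with
    | zero => exact wmat_mulVec_zero _
    | succ a =>
      rw [wmat_mulVec_succ]
      exact ih _ (by simp at ha ⊢; omega)

end Shift

/-- The upper shift of size `n`, perturbed in its first column and last row by the
coefficients of `p`. -/
noncomputable def perturbedShift {F : Type*} [Field F] (p : F[X]) (n : ℕ) :
    Matrix (Fin n) (Fin n) F :=
  Matrix.of fun a b => (if (b : ℕ) = a + 1 then 1 else 0) -
    ((if (b : ℕ) = 0 then p.coeff (a + 1) else 0) +
      (if (a : ℕ) = n - 1 then p.coeff (n - b) else 0))

/-- The first coefficients of `p`, as a vector. -/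
def coeffVec {F : Type*} [Field F] (p : F[X]) (m : ℕ) : Fin (m + 1) → F :=
  fun a => p.coeff a

/-- The first coefficients of `p` in reversed order, as a vector. -/
def revCoeffVec {F : Type*} [Field F] (p : F[X]) (m : ℕ) : Fin (m + 1) → F :=
  fun b => p.coeff (m - b)

section PerturbedShift

variable {F : Type*} [Field F] {m : ℕ} {p : F[X]}

theorem one_sub_wmat_mul_perturbedShift (hp : p.coeff 0 = 1) :
    1 - wmat F (m + 1) * perturbedShift p (m + 1) =
      vecMulVec (coeffVec p m) (Pi.single 0 1) := by
  ext a b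
  cases a using Fin.cases with
  | zero =>
    rw [Matrix.sub_apply, wmat_mul_zero]
    simp [vecMulVec_apply, coeffVec, hp, one_apply, Pi.single_apply, @eq_comm _ 0 b]
  | succ a =>
    rw [Matrix.sub_apply, wmat_mul_succ]
    have h : (a : ℕ) ≠ m := by omega
    by_cases hb : b = 0
    · subst hb
      simp [vecMulVec_apply, coeffVec, perturbedShift, one_apply, h]
    · have hab : a.succ = b ↔ (b : ℕ) = a + 1 := by rw [Fin.ext_iff, Fin.val_succ, eq_comm]
      simp [vecMulVec_apply, perturbedShift, one_apply, h, hb, hab]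

theorem one_sub_perturbedShift_mul_wmat (hp : p.coeff 0 = 1) :
    1 - perturbedShift p (m + 1) * wmat F (m + 1) =
      vecMulVec (Pi.single (Fin.last m) 1) (revCoeffVec p m) := by
  ext a b
  cases b using Fin.lastCases with
  | last =>
    rw [Matrix.sub_apply, mul_wmat_last]
    simp [vecMulVec_apply, revCoeffVec, hp, one_apply, Pi.single_apply]
  | cast b =>
    rw [Matrix.sub_apply, mul_wmat_castSucc]
    by_cases ha : a = Fin.last m
    · subst ha
      have h : (b : ℕ) ≠ m := by omega
      simp [vecMulVec_apply, revCoeffVec, perturbedShift, one_apply, h,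
        (Fin.castSucc_ne_last b).symm]
    · have ha' : (a : ℕ) ≠ m := fun h => ha (Fin.ext h)
      have hab : a = b.castSucc ↔ (b : ℕ) = a := by rw [Fin.ext_iff, Fin.val_castSucc, eq_comm]
      simp [vecMulVec_apply, perturbedShift, one_apply, ha, ha', hab]

theorem perturbedShift_mulVec_coeffVec (hp : p.coeff 0 = 1) (hd : 2 * p.natDegree < m + 1) :
    perturbedShift p (m + 1) *ᵥ coeffVec p m = 0 := by
  ext a
  have h : ∀ x : Fin (m + 1), p.coeff (m + 1 - x) * p.coeff x = 0 := fun x => by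
    rcases lt_or_ge p.natDegree x with hx | hx
    · rw [coeff_eq_zero_of_natDegree_lt hx, mul_zero]
    · rw [coeff_eq_zero_of_natDegree_lt (p := p) (n := m + 1 - x) (by omega), zero_mul]
  have h1 : ∑ x : Fin (m + 1), (if (x : ℕ) = a + 1 then p.coeff x else 0) = p.coeff (a + 1) := by
    cases a using Fin.lastCases with
    | last =>
      rw [coeff_eq_zero_of_natDegree_lt (n := (Fin.last m : ℕ) + 1) (by simp; omega)]
      refine Finset.sum_eq_zero fun x _ => if_neg ?_
      simp
      omega
    | cast a =>
      rw [Finset.sum_eq_single a.succ] <;> simp [Fin.ext_iff]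
      intro x hx hx'
      omega
  have h2 : ∑ x : Fin (m + 1), (if (x : ℕ) = 0 then p.coeff (a + 1) * p.coeff x else 0) =
      p.coeff (a + 1) := by
    simp only [Fin.val_eq_zero_iff, Finset.sum_ite_eq', Finset.mem_univ, if_true, Fin.val_zero, hp,
      mul_one]
  simp only [mulVec, dotProduct, perturbedShift, coeffVec, of_apply, sub_mul, add_mul, ite_mul,
    one_mul, zero_mul, h, ite_self, add_zero, Finset.sum_sub_distrib, h1, h2, sub_self,
    Pi.zero_apply]

theorem revCoeffVec_dotProduct_wmat_pow {i : ℕ} (hd : 2 * p.natDegree + i < m) :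
    revCoeffVec p m ⬝ᵥ (wmat F (m + 1) ^ i *ᵥ coeffVec p m) = 0 := by
  refine Finset.sum_eq_zero fun x _ => ?_
  rcases lt_or_ge (p.natDegree + i) x with hx | hx
  · rw [wmat_pow_mulVec_eq_zero (x := coeffVec p m) (fun a ha => coeff_eq_zero_of_natDegree_lt ha) i x hx, mul_zero]
  · rw [revCoeffVec, coeff_eq_zero_of_natDegree_lt (by omega), zero_mul]

theorem perturbedShift_pow_zero_apply {k : ℕ} (hk : k ≤ m) (b : Fin (m + 1)) (hb : k < b) :
    (perturbedShift p (m + 1) ^ k) 0 b = 0 := by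
  induction k generalizing b with
  | zero =>
    have : (0 : Fin (m + 1)) ≠ b := by
      rintro rfl
      simp at hb
    simp [one_apply, this]
  | succ k ih =>
    rw [pow_succ, mul_apply]
    refine Finset.sum_eq_zero fun x _ => ?_
    rcases lt_or_ge k x with hx | hx
    · rw [ih (by omega) x hx, zero_mul]
    · have h1 : (b : ℕ) ≠ x + 1 := by omega
      have h2 : (b : ℕ) ≠ 0 := by omega
      have h3 : (x : ℕ) ≠ m + 1 - 1 := by omega
      rw [perturbedShift, of_apply, if_neg h1, if_neg h2, if_neg h3, add_zero, sub_zero, mul_zero]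

theorem rank_vecMulVec_eq_one {n : Type*} [Fintype n] [DecidableEq n] {u v : n → F}
    (hu : u ≠ 0) (hv : v ≠ 0) : (vecMulVec u v).rank = 1 := by
  refine le_antisymm (rank_vecMulVec_le u v) (Nat.one_le_iff_ne_zero.2 fun h => ?_)
  rw [Matrix.rank, Submodule.finrank_eq_zero, LinearMap.range_eq_bot, ← mulVecLin_zero] at h
  exact vecMulVec_ne_zero hu hv (ext_of_mulVec_single fun i => LinearMap.congr_fun h _)

theorem coeffVec_ne_zero (hp : p.coeff 0 = 1) : coeffVec p m ≠ 0 := fun h => by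
  simpa [coeffVec, hp] using congrFun h 0

theorem revCoeffVec_ne_zero (hp : p.coeff 0 = 1) : revCoeffVec p m ≠ 0 := fun h => by
  simpa [revCoeffVec, hp] using congrFun h (Fin.last m)

end PerturbedShift

theorem Fk_coeff_zero {F : Type*} [Field F] {f : ℕ → F[X]} (hf : ∀ m, (f m).coeff 0 = 1)
    (k : ℕ) : (Fk f k).coeff 0 = 1 := by
  simp [Fk, coeff_zero_prod, hf]

theorem exists_wstarmat_eq {F : Type*} [Field F] {f : ℕ → F[X]} {M : ℕ → ℕ}
    (hf : ∀ m, (f m).coeff 0 = 1) (hM1 : 1 ≤ M 1)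
    (hMN : ∀ k : ℕ, 1 ≤ k → 2 * (k + 1) * Nk f k ≤ M k) (n : ℕ) :
    ∃ p : F[X], p.coeff 0 = 1 ∧ 4 * p.natDegree ≤ n ∧ wstarmat f M n = perturbedShift p n := by
  by_cases h : M 1 ≤ n
  · have hk : 1 ≤ kidx M n := Nat.le_findGreatest (hM1.trans h) h
    have hkn : M (kidx M n) ≤ n :=
      Nat.findGreatest_spec (P := fun k => M k ≤ n) (hM1.trans h) h
    refine ⟨Fk f (kidx M n), Fk_coeff_zero hf _, ?_, ?_⟩
    · refine le_trans ?_ ((hMN _ hk).trans hkn)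
      exact Nat.mul_le_mul_right _ (by omega)
    · ext a b
      simp [wstarmat, perturbedShift, h]
  · refine ⟨1, by simp, by simp, ?_⟩
    ext a b
    have : n - (b : ℕ) ≠ 0 := by omega
    simp [wstarmat, perturbedShift, h, coeff_one, this]

end SkewConstruction

open SkewConstruction in
/-- Lemma 5.1 of the paper: basic properties of the matrices `wₙ`, `wₙ*`. -/
theorem stmt5 {F : Type*} [Field F] [Countable F]
    (f : ℕ → F[X]) (hf0 : f 0 = 1)
    (hfmem : ∀ m : ℕ, (f m).coeff 0 = 1)
    (hfenum : ∀ p : F[X], p.coeff 0 = 1 → ∃ m : ℕ, f m = p)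
    (M : ℕ → ℕ) (hM : StrictMono M) (hM1 : 1 ≤ M 1)
    (hMN : ∀ k : ℕ, 1 ≤ k → 2 * (k + 1) * Nk f k ≤ M k) :
    -- (a)
    (∀ n : ℕ, 1 ≤ n →
      wmat F n * wstarmat f M n * wmat F n = wmat F n ∧
      wstarmat f M n * wmat F n * wstarmat f M n = wstarmat f M n) ∧
    -- (b) `1 − wₙwₙ*` and `1 − wₙ*wₙ` are rank one idempotents, orthogonal for `n ≥ 2`
    (∀ n : ℕ, 1 ≤ n →
      (1 - wmat F n * wstarmat f M n) * (1 - wmat F n * wstarmat f M n) =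
        1 - wmat F n * wstarmat f M n ∧
      (1 - wstarmat f M n * wmat F n) * (1 - wstarmat f M n * wmat F n) =
        1 - wstarmat f M n * wmat F n ∧
      (1 - wmat F n * wstarmat f M n).rank = 1 ∧
      (1 - wstarmat f M n * wmat F n).rank = 1 ∧
      (2 ≤ n →
        (1 - wmat F n * wstarmat f M n) * (1 - wstarmat f M n * wmat F n) = 0 ∧
        (1 - wstarmat f M n * wmat F n) * (1 - wmat F n * wstarmat f M n) = 0)) ∧
    -- (c)
    (∀ l i : ℕ, l ≤ i → ∃ n₀ : ℕ, ∀ n : ℕ, n₀ ≤ n →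
      (wstarmat f M n) ^ l * (wmat F n) ^ i * (1 - wmat F n * wstarmat f M n) =
        (wmat F n) ^ (i - l) * (1 - wmat F n * wstarmat f M n)) ∧
    -- (d)
    (∀ i l : ℕ, i < l → ∃ n₀ : ℕ, ∀ n : ℕ, n₀ ≤ n →
      (wstarmat f M n) ^ l * (wmat F n) ^ i * (1 - wmat F n * wstarmat f M n) = 0) ∧
    -- (e)
    (∀ l j : ℕ, l ≤ j → ∃ n₀ : ℕ, ∀ n : ℕ, n₀ ≤ n →
      (1 - wmat F n * wstarmat f M n) * (wstarmat f M n) ^ j * (wmat F n) ^ l =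
        (1 - wmat F n * wstarmat f M n) * (wstarmat f M n) ^ (j - l)) ∧
    -- (f)
    (∀ j l : ℕ, j < l → ∃ n₀ : ℕ, ∀ n : ℕ, n₀ ≤ n →
      (1 - wmat F n * wstarmat f M n) * (wstarmat f M n) ^ j * (wmat F n) ^ l = 0) := by
  have key : ∀ n : ℕ, 1 ≤ n → ∃ (m : ℕ) (p : F[X]), n = m + 1 ∧ p.coeff 0 = 1 ∧
      4 * p.natDegree ≤ m + 1 ∧ wstarmat f M (m + 1) = perturbedShift p (m + 1) := by
    intro n hn
    obtain ⟨m, rfl⟩ := Nat.exists_eq_add_of_le' hn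
    obtain ⟨p, hp⟩ := exists_wstarmat_eq hfmem hM1 hMN (m + 1)
    exact ⟨m, p, rfl, hp⟩
  have hPw : ∀ n : ℕ, 1 ≤ n → (1 - wmat F n * wstarmat f M n) * wmat F n = 0 := by
    intro n hn
    obtain ⟨m, p, rfl, hp, hd, hs⟩ := key n hn
    rw [hs, one_sub_wmat_mul_perturbedShift hp, Matrix.vecMulVec_mul, single_zero_vecMul_wmat,
      Matrix.vecMulVec_zero]
  have hsP : ∀ n : ℕ, 1 ≤ n → wstarmat f M n * (1 - wmat F n * wstarmat f M n) = 0 := by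
    intro n hn
    obtain ⟨m, p, rfl, hp, hd, hs⟩ := key n hn
    rw [hs, one_sub_wmat_mul_perturbedShift hp, Matrix.mul_vecMulVec,
      perturbedShift_mulVec_coeffVec hp (by omega), Matrix.zero_vecMulVec]
  have hQP : ∀ i n : ℕ, 2 * i + 4 ≤ 2 * n → 2 * i + 2 < n ∨ i = 0 →
      (1 - wstarmat f M n * wmat F n) * (wmat F n ^ i * (1 - wmat F n * wstarmat f M n)) = 0 := by
    intro i n hn hi
    obtain ⟨m, p, rfl, hp, hd, hs⟩ := key n (by omega)
    rw [hs, one_sub_wmat_mul_perturbedShift hp, one_sub_perturbedShift_mul_wmat hp,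
      Matrix.mul_vecMulVec, Matrix.vecMulVec_mul_vecMulVec,
      revCoeffVec_dotProduct_wmat_pow (by omega)]
    simp
  have hPQ : ∀ j n : ℕ, j + 2 ≤ n →
      (1 - wmat F n * wstarmat f M n) * wstarmat f M n ^ j * (1 - wstarmat f M n * wmat F n) =
        0 := by
    intro j n hn
    obtain ⟨m, p, rfl, hp, hd, hs⟩ := key n (by omega)
    rw [hs, one_sub_wmat_mul_perturbedShift hp, one_sub_perturbedShift_mul_wmat hp,
      Matrix.mul_assoc, Matrix.mul_vecMulVec, Matrix.vecMulVec_mul_vecMulVec]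
    simp [perturbedShift_pow_zero_apply (p := p) (show j ≤ m by omega) (Fin.last m)
      (by simp; omega)]
  have hc : ∀ l i : ℕ, l ≤ i → ∀ n : ℕ, 2 * i + 3 ≤ n →
      wstarmat f M n ^ l * wmat F n ^ i * (1 - wmat F n * wstarmat f M n) =
        wmat F n ^ (i - l) * (1 - wmat F n * wstarmat f M n) := fun l i hl n hn =>
    pow_mul_pow_mul_eq (fun k hk => hQP k n (by omega) (by omega)) hl
  have he : ∀ l j : ℕ, l ≤ j → ∀ n : ℕ, j + 2 ≤ n →
      (1 - wmat F n * wstarmat f M n) * wstarmat f M n ^ j * wmat F n ^ l =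
        (1 - wmat F n * wstarmat f M n) * wstarmat f M n ^ (j - l) := fun l j hl n hn =>
    mul_pow_mul_pow_eq (fun k hk => hPQ k n (by omega)) hl
  refine ⟨fun n hn => ⟨?_, ?_⟩, fun n hn => ⟨?_, ?_, ?_, ?_, fun hn2 => ⟨?_, ?_⟩⟩,
    fun l i hl => ⟨_, hc l i hl⟩, fun i l hl => ⟨2 * i + 3, fun n hn => ?_⟩,
    fun l j hl => ⟨_, he l j hl⟩, fun j l hl => ⟨j + 2, fun n hn => ?_⟩⟩
  · have h := hPw n hn
    rwa [sub_mul, one_mul, sub_eq_zero, eq_comm] at h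
  · have h := hsP n hn
    rwa [mul_sub, mul_one, sub_eq_zero, eq_comm, ← mul_assoc] at h
  · rw [mul_sub, mul_one, ← mul_assoc, hPw n hn, zero_mul, sub_zero]
  · have h := hsP n hn
    rw [mul_sub, mul_one, sub_eq_zero] at h
    have h' : (1 - wstarmat f M n * wmat F n) * wstarmat f M n = 0 := by
      rw [sub_mul, one_mul, mul_assoc, ← h, sub_self]
    rw [mul_sub, mul_one, ← mul_assoc, h', zero_mul, sub_zero]
  · obtain ⟨m, p, rfl, hp, hd, hs⟩ := key n hn
    rw [hs, one_sub_wmat_mul_perturbedShift hp]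
    exact rank_vecMulVec_eq_one (coeffVec_ne_zero hp) (by simp)
  · obtain ⟨m, p, rfl, hp, hd, hs⟩ := key n hn
    rw [hs, one_sub_perturbedShift_mul_wmat hp]
    exact rank_vecMulVec_eq_one (by simp) (revCoeffVec_ne_zero hp)
  · simpa using hPQ 0 n hn2
  · simpa using hQP 0 n (by omega) (by simp)
  · obtain ⟨d, rfl⟩ := Nat.exists_eq_add_of_lt hl
    rw [show i + d + 1 = d + 1 + i by omega, pow_add, mul_assoc, mul_assoc, ← mul_assoc _ _ (1 - _),
      hc i i le_rfl n hn, Nat.sub_self, pow_zero, one_mul, pow_succ, mul_assoc,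
      hsP n (by omega), mul_zero]
  · obtain ⟨d, rfl⟩ := Nat.exists_eq_add_of_lt hl
    rw [show j + d + 1 = j + (1 + d) by omega, pow_add, ← mul_assoc, he j j le_rfl n hn,
      Nat.sub_self, pow_zero, mul_one, pow_add, pow_one, ← mul_assoc,
      hPw n (by omega), zero_mul]
end

section
/- Let B₀ be the unital K-subalgebra of T = ∏_{i=1}^∞ M_i(K) generated by w and w*. Then: (i) B₀ contains the ideal ⊕_{i=1}^∞ M_i(K); (ii) ⊕_{i=1}^∞ M_i(K) is an essential right ideal of B₀, i.e., for every nonzero x ∈ B₀ there exists r ∈ B₀ such that x·r ≠ 0 and x·r ∈ ⊕_{i=1}^∞ M_i(K). -/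
set_option synthInstance.maxHeartbeats 1000000
set_option maxHeartbeats 1000000

namespace ShiftProduct

/-- `T = ∏_{i=1}^∞ M_i(K)`; the index `n : ℕ` corresponds to the factor `M_{n+1}(K)`. -/
abbrev TProd (K : Type*) [Field K] : Type _ :=
  ∀ n : ℕ, Matrix (Fin (n + 1)) (Fin (n + 1)) K

/-- the element `w = (w_i)_i ∈ T`, where `w_i` is the lower shift matrix of size `i`. -/
def wT (K : Type*) [Field K] : TProd K :=
  fun n => Matrix.of fun (a b : Fin (n + 1)) => if (a : ℕ) = (b : ℕ) + 1 then (1 : K) else 0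

/-- the element `w* ∈ T`, the componentwise transpose of `w`. -/
def wstarT (K : Type*) [Field K] : TProd K :=
  fun n => (wT K n).transpose

/-- `⊕_{i=1}^∞ M_i(K)`, the ideal of sequences with finitely many nonzero components. -/
def socSet (K : Type*) [Field K] : Set (TProd K) :=
  {x | ∃ N : ℕ, ∀ n : ℕ, N ≤ n → x n = 0}

/-- the unital `K`-subalgebra of `T` generated by `w` and `w*`
(the image of the semigroup algebra `K[𝓕]` of the monogenic free inverse monoid). -/
def B0 (K : Type*) [Field K] : Subalgebra K (TProd K) :=
  Algebra.adjoin K {wT K, wstarT K}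

end ShiftProduct

namespace ShiftProduct

variable {K : Type*} [Field K]

theorem wT_pow_apply (k n : ℕ) (a b : Fin (n + 1)) :
    (wT K ^ k) n a b = if (a : ℕ) = b + k then 1 else 0 := by
  induction k generalizing a with
  | zero => simp [Matrix.one_apply, Fin.ext_iff]
  | succ k ih =>
    rw [pow_succ', Pi.mul_apply, Matrix.mul_apply]
    simp only [ih, wT, Matrix.of_apply, ← ite_and, mul_ite, mul_one, mul_zero]
    by_cases h : (a : ℕ) = b + (k + 1)
    · rw [if_pos h, Finset.sum_eq_single ⟨b + k, by omega⟩]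
      · simp; omega
      · intro c _ hc
        rw [if_neg]
        rintro ⟨h1, _⟩
        exact hc (Fin.ext h1)
      · simp
    · rw [if_neg h]
      refine Finset.sum_eq_zero fun c _ => if_neg ?_
      omega

theorem wstarT_pow_apply (k n : ℕ) (a b : Fin (n + 1)) :
    (wstarT K ^ k) n a b = if (b : ℕ) = a + k then 1 else 0 := by
  rw [← wT_pow_apply, Pi.pow_apply, Pi.pow_apply, wstarT, ← Matrix.transpose_pow,
    Matrix.transpose_apply]

theorem wstarT_pow_mul_wT_pow_apply (k n : ℕ) (a b : Fin (n + 1)) :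
    (wstarT K ^ k * wT K ^ k) n a b = if a = b ∧ (a : ℕ) + k ≤ n then 1 else 0 := by
  rw [Pi.mul_apply, Matrix.mul_apply]
  simp only [wstarT_pow_apply, wT_pow_apply, mul_ite, mul_one, mul_zero, ← ite_and]
  by_cases h : a = b ∧ (a : ℕ) + k ≤ n
  · obtain ⟨rfl, h⟩ := h
    rw [if_pos ⟨rfl, h⟩, Finset.sum_eq_single ⟨a + k, by omega⟩]
    · simp
    · intro c _ hc
      rw [if_neg]
      rintro ⟨h1, _⟩
      exact hc (Fin.ext h1)
    · simp
  · rw [if_neg h]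
    refine Finset.sum_eq_zero fun c _ => if_neg ?_
    have := c.isLt
    rw [Fin.ext_iff] at h
    omega

theorem wT_mul_wstarT_apply (n : ℕ) (a b : Fin (n + 1)) :
    (wT K * wstarT K) n a b = if a = b ∧ a ≠ 0 then 1 else 0 := by
  rw [Pi.mul_apply, Matrix.mul_apply]
  simp only [wstarT, Matrix.transpose_apply, wT, Matrix.of_apply, mul_ite, mul_one, mul_zero,
    ← ite_and]
  by_cases h : a = b ∧ a ≠ 0
  · obtain ⟨rfl, h0⟩ := h
    have h : (a : ℕ) ≠ 0 := Fin.val_ne_zero_iff.mpr h0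
    rw [if_pos ⟨rfl, h0⟩, Finset.sum_eq_single ⟨a - 1, by omega⟩]
    · rw [if_pos]
      simp only
      omega
    · intro c _ hc
      rw [if_neg]
      rw [Ne, Fin.ext_iff] at hc
      simp only at hc
      omega
    · simp
  · rw [if_neg h]
    refine Finset.sum_eq_zero fun c _ => if_neg ?_
    rw [Ne, Fin.ext_iff, Fin.ext_iff, Fin.val_zero] at h
    omega

/-- The matrix unit at the top left corner of the `n`-th factor, as an expression in `w`, `w*`. -/
theorem corner_eq (n : ℕ) :
    (1 - wT K * wstarT K) *
      (wstarT K ^ n * wT K ^ n - wstarT K ^ (n + 1) * wT K ^ (n + 1)) =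
    Pi.single n (Matrix.single 0 0 1) := by
  have h1 (m : ℕ) : (1 - wT K * wstarT K) m = Matrix.single 0 0 1 := by
    ext a b
    rw [Pi.sub_apply, Matrix.sub_apply, wT_mul_wstarT_apply, Pi.one_apply, Matrix.one_apply,
      Matrix.single_apply]
    grind
  funext m
  rw [Pi.mul_apply, h1]
  ext a b
  by_cases ha : a = 0
  · subst ha
    rw [Matrix.single_mul_apply_same, Pi.sub_apply, Matrix.sub_apply,
      wstarT_pow_mul_wT_pow_apply, wstarT_pow_mul_wT_pow_apply, one_mul]
    rcases eq_or_ne m n with rfl | hm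
    · simp [Matrix.single_apply]
    · rw [Pi.single_eq_of_ne hm]
      have h : n + 1 ≤ m ↔ n ≤ m := by omega
      simp [h]
  · rw [Matrix.single_mul_apply_of_ne _ _ _ _ _ ha]
    rcases eq_or_ne m n with rfl | hm
    · simp [Ne.symm ha]
    · simp [Pi.single_eq_of_ne hm]

theorem wT_mem : wT K ∈ B0 K := Algebra.subset_adjoin (by simp)

theorem wstarT_mem : wstarT K ∈ B0 K := Algebra.subset_adjoin (by simp)

theorem wT_pow_mul_corner_mul_wstarT_pow (n : ℕ) (i j : Fin (n + 1)) :
    wT K ^ (i : ℕ) * Pi.single n (Matrix.single 0 0 1) * wstarT K ^ (j : ℕ) =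
      Pi.single n (Matrix.single i j 1) := by
  funext m
  rw [Pi.mul_apply, Pi.mul_apply]
  rcases eq_or_ne m n with rfl | hm
  · rw [Pi.single_eq_same, Pi.single_eq_same]
    ext a b
    rw [Matrix.mul_apply, Finset.sum_eq_single 0]
    · rw [Matrix.mul_single_apply_same, wT_pow_apply, wstarT_pow_apply, Matrix.single_apply]
      simp only [Fin.ext_iff, Fin.val_zero]
      grind
    · intro c _ hc
      rw [Matrix.mul_single_apply_of_ne _ _ _ _ _ hc, zero_mul]
    · simp
  · simp [Pi.single_eq_of_ne hm]

theorem single_single_mem (n : ℕ) (i j : Fin (n + 1)) :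
    (Pi.single n (Matrix.single i j 1) : TProd K) ∈ B0 K := by
  have hw := wT_mem (K := K)
  have hs := wstarT_mem (K := K)
  rw [← wT_pow_mul_corner_mul_wstarT_pow, ← corner_eq]
  exact mul_mem (mul_mem (pow_mem hw _) (mul_mem (sub_mem (one_mem _) (mul_mem hw hs))
    (sub_mem (mul_mem (pow_mem hs _) (pow_mem hw _))
      (mul_mem (pow_mem hs _) (pow_mem hw _))))) (pow_mem hs _)

theorem single_mem (n : ℕ) (A : Matrix (Fin (n + 1)) (Fin (n + 1)) K) :
    (Pi.single n A : TProd K) ∈ B0 K := by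
  have key : ∀ A, LinearMap.single K
      (fun n : ℕ => Matrix (Fin (n + 1)) (Fin (n + 1)) K) n A ∈ B0 K := by
    intro A
    rw [Matrix.matrix_eq_sum_single A, map_sum]
    refine sum_mem fun i _ => ?_
    rw [map_sum]
    refine sum_mem fun j _ => ?_
    have h : Matrix.single i j (A i j) = A i j • Matrix.single i j (1 : K) := by simp
    rw [h, map_smul]
    exact (B0 K).smul_mem (single_single_mem n i j) _
  exact key A

theorem socSet_subset_B0 : socSet K ⊆ (B0 K : Set (TProd K)) := by
  rintro x ⟨N, hN⟩
  have hx : x = ∑ n ∈ Finset.range N, Pi.single n (x n) := by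
    funext m
    rw [Finset.sum_apply, Finset.sum_pi_single]
    split_ifs with h
    · rfl
    · exact hN m (by simpa using h)
  rw [hx]
  exact sum_mem fun n _ => single_mem n (x n)

end ShiftProduct

open ShiftProduct in
/-- Proposition 3.5 of the paper, for the subalgebra `B₀ ≅ K[𝓕]` of `T`:
`⊕ M_i(K) ⊆ B₀`, and `⊕ M_i(K)` is an essential right ideal of `B₀`. -/
theorem stmt9 {K : Type*} [Field K] :
    socSet K ⊆ (B0 K : Set (TProd K)) ∧
    ∀ x ∈ B0 K, x ≠ 0 → ∃ r ∈ B0 K, x * r ≠ 0 ∧ x * r ∈ socSet K := by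
  refine ⟨socSet_subset_B0, fun x _ hx => ?_⟩
  obtain ⟨n, hn⟩ := Function.ne_iff.mp hx
  refine ⟨Pi.single n 1, single_mem n 1, fun h => hn ?_, n + 1, fun m hm => ?_⟩
  · simpa using congrFun h n
  · rw [Pi.mul_apply, Pi.single_eq_of_ne (by omega), mul_zero]
end

section
/- Let f(x) = 1 + a₁x + ⋯ + a_nx^n with a₁, …, a_n ∈ k, and set f₁(x) = ā_n + ā_{n−1}x + ⋯ + ā₁x^{n−1} + x^n (where ā denotes the complex conjugate) and, for 0 ≤ i ≤ n−1, P_i(x) = −∑_{j=0}^{i} a_{n−j}x^{i−j}. Then for every m ≥ n the following identity holds in M_m(k): f₁(w_m) = w_m^n·f(w_m)ᴴ − ∑_{i=0}^{n−1} w_m^i·(1 − w_m·w_mᴴ)·P_i(w_m)ᴴ, where ᴴ denotes the conjugate transpose. -/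
/-- A telescoping sum: only the boundary terms of
`W ^ i * (1 - W * V) * V ^ r = W ^ i * V ^ r - W ^ (i + 1) * V ^ (r + 1)` survive. -/
theorem sum_pow_mul_one_sub_mul_sum_smul_pow {R A : Type*} [CommSemiring R] [Ring A] [Algebra R A]
    (W V : A) (c : ℕ → R) (n : ℕ) :
    ∑ i ∈ Finset.range n, W ^ i * (1 - W * V) * ∑ j ∈ Finset.range (i + 1), c j • V ^ (i - j) =
      ∑ j ∈ Finset.range n, c j • (W ^ j - W ^ n * V ^ (n - j)) := by
  induction n with
  | zero => simp
  | succ n ih =>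
    have key : ∀ j ∈ Finset.range (n + 1), W ^ n * (1 - W * V) * c j • V ^ (n - j) =
        c j • (W ^ j - W ^ (n + 1) * V ^ (n + 1 - j)) - c j • (W ^ j - W ^ n * V ^ (n - j)) := by
      intro j hj
      rw [Nat.succ_sub (Finset.mem_range_succ_iff.mp hj), mul_smul_comm, ← smul_sub, pow_succ W n,
        pow_succ' V]
      congr 1
      noncomm_ring
    have hn : ∑ j ∈ Finset.range (n + 1), c j • (W ^ j - W ^ n * V ^ (n - j)) =
        ∑ j ∈ Finset.range n, c j • (W ^ j - W ^ n * V ^ (n - j)) := by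
      simp [Finset.sum_range_succ]
    rw [Finset.sum_range_succ, ih, Finset.mul_sum, Finset.sum_congr rfl key,
      Finset.sum_sub_distrib, hn, add_sub_cancel]


/-- Lemma 6.9 of the paper: with `f(x) = 1 + a₁x + ⋯ + aₙxⁿ` (coefficients in a subfield
`k ⊆ ℂ` closed under conjugation), `f₁(x) = āₙ + ā_{n−1}x + ⋯ + ā₁x^{n−1} + xⁿ` and
`P_i(x) = −∑_{j=0}^{i} a_{n−j} x^{i−j}`, the identity
`f₁(w_m) = w_mⁿ · f(w_m)ᴴ − ∑_{i=0}^{n−1} w_m^i (1 − w_m w_mᴴ) P_i(w_m)ᴴ`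
holds in `M_m(k)` for every `m ≥ n`, where `w_m` is the lower shift matrix. -/
theorem stmt10 (K : Subfield ℂ) (hK : ∀ z ∈ K, (starRingEnd ℂ) z ∈ K)
    (m n : ℕ) (hmn : n ≤ m) (a : ℕ → ℂ) (ha : ∀ i : ℕ, a i ∈ K)
    (W : Matrix (Fin m) (Fin m) ℂ)
    (hW : W = Matrix.of fun (p q : Fin m) => if (p : ℕ) = (q : ℕ) + 1 then (1 : ℂ) else 0)
    (fW f1W : Matrix (Fin m) (Fin m) ℂ) (P : ℕ → Matrix (Fin m) (Fin m) ℂ)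
    (hfW : fW = 1 + ∑ i ∈ Finset.Icc 1 n, a i • W ^ i)
    (hf1W : f1W = W ^ n + ∑ i ∈ Finset.range n, (starRingEnd ℂ) (a (n - i)) • W ^ i)
    (hP : ∀ i : ℕ, i ≤ n - 1 → P i = -(∑ j ∈ Finset.range (i + 1), a (n - j) • W ^ (i - j))) :
    f1W = W ^ n * fW.conjTranspose -
      ∑ i ∈ Finset.range n, W ^ i * (1 - W * W.conjTranspose) * (P i).conjTranspose := by
  have hPH : ∀ i ∈ Finset.range n, W ^ i * (1 - W * W.conjTranspose) * (P i).conjTranspose =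
      -(W ^ i * (1 - W * W.conjTranspose) * ∑ j ∈ Finset.range (i + 1),
        (starRingEnd ℂ) (a (n - j)) • W.conjTranspose ^ (i - j)) := by
    intro i hi
    rw [hP i (Nat.le_sub_one_of_lt (Finset.mem_range.mp hi)), Matrix.conjTranspose_neg,
      Matrix.conjTranspose_sum, mul_neg]
    simp only [Matrix.conjTranspose_smul, Matrix.conjTranspose_pow, starRingEnd_apply]
  have hfH : fW.conjTranspose =
      1 + ∑ j ∈ Finset.range n, (starRingEnd ℂ) (a (n - j)) • W.conjTranspose ^ (n - j) := by
    have hreflect : ∑ i ∈ Finset.Icc 1 n, a i • W ^ i =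
        ∑ j ∈ Finset.range n, a (n - j) • W ^ (n - j) := by
      refine Finset.sum_bij' (fun i _ => n - i) (fun j _ => n - j) ?_ ?_ ?_ ?_ ?_ <;>
        intro i hi <;> simp only [Finset.mem_Icc, Finset.mem_range] at hi ⊢
      any_goals omega
      rw [Nat.sub_sub_self hi.2]
    rw [hfW, hreflect, Matrix.conjTranspose_add, Matrix.conjTranspose_one,
      Matrix.conjTranspose_sum]
    simp only [Matrix.conjTranspose_smul, Matrix.conjTranspose_pow, starRingEnd_apply]
  rw [Finset.sum_congr rfl hPH, Finset.sum_neg_distrib, sub_neg_eq_add,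
    sum_pow_mul_one_sub_mul_sum_smul_pow W W.conjTranspose
      (fun j => (starRingEnd ℂ) (a (n - j))), hfH, hf1W, mul_add, mul_one, Finset.mul_sum,
    add_assoc, ← Finset.sum_add_distrib]
  simp only [smul_sub, mul_smul_comm, add_sub_cancel]
end
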